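/- arXiv:1503.05019 — 7 statements merged into one kernel-verified Lean document; each statement's English description precedes it below -/
import Mathlib

section
/- Let I ⊆ ℝ be a compact interval, γ ∈ (0,1], and K, M > 0. Suppose f : I → ℝ is differentiable on I with |f′(x)| ≤ M for all x ∈ I and |f′(x) − f′(y)| ≤ K|x − y|^γ for all x, y ∈ I. Then the piecewise-linear approximation f̂_m satisfies ∫_I (f(x) − f̂_m(x))² ν₀(dx) ≤ 2μ (Mℓ_m + 5Kℓ_m^{1+γ})² + 25 K² ν₀(I) ℓ_m^{2+2γ}. In particular, ∫_I (f − f̂_m)² dν₀ = O(μ ℓ_m² + ℓ_m^{2+2γ}) with the implied constant depending only on K, M, γ and ν₀(I). -/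
open MeasureTheory

/-- First-order Taylor estimate for a function whose derivative is `γ`-Hölder on an interval. -/
theorem abs_sub_sub_deriv_mul_le_of_holder {a b γ K : ℝ} (hγ : 0 < γ) (hK : 0 < K)
    {f f' : ℝ → ℝ}
    (hderiv : ∀ x ∈ Set.Icc a b, HasDerivWithinAt f (f' x) (Set.Icc a b) x)
    (hHolder : ∀ x ∈ Set.Icc a b, ∀ y ∈ Set.Icc a b, |f' x - f' y| ≤ K * |x - y| ^ γ)
    {x y : ℝ} (hx : x ∈ Set.Icc a b) (hy : y ∈ Set.Icc a b) :
    |f x - f y - f' y * (x - y)| ≤ K * |x - y| ^ (1 + γ) := by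
  have hsub : Set.uIcc y x ⊆ Set.Icc a b := Set.uIcc_subset_Icc hy hx
  have h := (convex_uIcc y x).norm_image_sub_le_of_norm_hasDerivWithin_le
    (f := fun t => f t - f' y * t) (f' := fun t => f' t - f' y) (C := K * |x - y| ^ γ)
    (fun t ht => by
      have h1 := (hderiv t (hsub ht)).mono hsub
      have h2 := ((hasDerivWithinAt_id t (Set.uIcc y x)).const_mul (f' y))
      rw [mul_one] at h2
      exact h1.sub h2)
    (fun t ht => by
      refine (hHolder t (hsub ht) y hy).trans ?_
      gcongr K * ?_ ^ γ
      exact Set.abs_sub_left_of_mem_uIcc ht)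
    Set.left_mem_uIcc Set.right_mem_uIcc
  rw [Real.norm_eq_abs, Real.norm_eq_abs] at h
  calc |f x - f y - f' y * (x - y)| = |f x - f' y * x - (f y - f' y * y)| := by
        congr 1; ring
    _ ≤ K * |x - y| ^ γ * |x - y| := h
    _ = K * |x - y| ^ (1 + γ) := by
        rw [add_comm 1 γ, Real.rpow_add_of_nonneg (abs_nonneg _) hγ.le zero_le_one, Real.rpow_one]
        ring

/-- An average over a set of positive mass is at most any upper bound. -/
theorem setIntegral_div_le_of_forall_le {ν : Measure ℝ} [IsFiniteMeasure ν] {s : Set ℝ}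
    (hs : MeasurableSet s) {μ : ℝ} (hμ : 0 < μ) (hmass : ν.real s = μ) {g : ℝ → ℝ}
    (hg : IntegrableOn g s ν) {c : ℝ} (h : ∀ y ∈ s, g y ≤ c) : (∫ y in s, g y ∂ν) / μ ≤ c := by
  rw [div_le_iff₀ hμ]
  calc ∫ y in s, g y ∂ν ≤ ∫ _ in s, c ∂ν :=
        setIntegral_mono_on hg (integrableOn_const (measure_ne_top _ _)) hs h
    _ = c * μ := by rw [setIntegral_const, hmass, smul_eq_mul, mul_comm]

/-- An average over a set of positive mass is at least any lower bound. -/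
theorem le_setIntegral_div_of_forall_le {ν : Measure ℝ} [IsFiniteMeasure ν] {s : Set ℝ}
    (hs : MeasurableSet s) {μ : ℝ} (hμ : 0 < μ) (hmass : ν.real s = μ) {g : ℝ → ℝ}
    (hg : IntegrableOn g s ν) {c : ℝ} (h : ∀ y ∈ s, c ≤ g y) : c ≤ (∫ y in s, g y ∂ν) / μ := by
  rw [le_div_iff₀ hμ]
  calc c * μ = ∫ _ in s, c ∂ν := by rw [setIntegral_const, hmass, smul_eq_mul, mul_comm]
    _ ≤ ∫ y in s, g y ∂ν :=
        setIntegral_mono_on (integrableOn_const (measure_ne_top _ _)) hg hs h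

/-- Linear interpolation of two values that are `B`-close to an affine function is `B`-close to
that affine function. -/
theorem abs_sub_interpolation_le {p q x u v c d B : ℝ} (hp : p < x) (hq : x ≤ q)
    (hu : |u - c - d * (q - x)| ≤ B) (hv : |v - c - d * (p - x)| ≤ B) :
    |c - (u * (x - p) + v * (q - x)) / (q - p)| ≤ B := by
  have hpq : 0 < q - p := by linarith
  rw [abs_le] at hu hv
  have h1 : 0 ≤ x - p := by linarith
  have h2 : 0 ≤ q - x := by linarith
  have e : c - (u * (x - p) + v * (q - x)) / (q - p) =
      -((u - c - d * (q - x)) * (x - p) + (v - c - d * (p - x)) * (q - x)) / (q - p) := by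
    field_simp
    ring
  rw [e, abs_le, le_div_iff₀ hpq, div_le_iff₀ hpq]
  constructor <;>
    nlinarith [mul_le_mul_of_nonneg_right hu.1 h1, mul_le_mul_of_nonneg_right hu.2 h1,
      mul_le_mul_of_nonneg_right hv.1 h2, mul_le_mul_of_nonneg_right hv.2 h2]

/-- A point between the first and last terms of a finite sequence lies in one of the half-open
intervals formed by consecutive terms. -/
theorem exists_mem_Ioc_consecutive {x : ℝ} (s : ℕ → ℝ) (n : ℕ) (h0 : s 0 < x) (hn : x ≤ s n) :
    ∃ j < n, x ∈ Set.Ioc (s j) (s (j + 1)) := by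
  induction n with
  | zero => exact absurd hn (not_le.mpr h0)
  | succ n ih =>
    rcases le_or_gt x (s n) with h | h
    · obtain ⟨j, hj, hx⟩ := ih h
      exact ⟨j, hj.trans n.lt_succ_self, hx⟩
    · exact ⟨n, n.lt_succ_self, h, hn⟩

/-- Let `I = [a,b]` be a compact interval, `ν₀` a finite Borel measure on it,
`J₁, …, J_m` an equal-`ν₀`-mass partition of `I` into consecutive intervals of mass
`μ = ν₀(I)/m`, with barycenters `x_j*` and `ℓ_m = max_j diam (J_j)`. If `f` is differentiable
with `|f′| ≤ M` and `|f′(x) − f′(y)| ≤ K|x−y|^γ` on `I`, then the piecewise-linear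
approximation `f̂_m` (linear interpolation of the cell averages at the barycenters) satisfies
`∫_I (f − f̂_m)² dν₀ ≤ 2μ (Mℓ_m + 5Kℓ_m^{1+γ})² + 25 K² ν₀(I) ℓ_m^{2+2γ}`. -/
theorem stmt_0
    (a b : ℝ) (hab : a ≤ b)
    (ν₀ : Measure ℝ) [IsFiniteMeasure ν₀]
    (γ : ℝ) (hγ0 : 0 < γ) (hγ1 : γ ≤ 1)
    (K M : ℝ) (hK : 0 < K) (hM : 0 < M)
    (m : ℕ) (hm : 2 ≤ m)
    (J : Fin m → Set ℝ)
    (hJint : ∀ j, (J j).OrdConnected)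
    (hJdisj : ∀ i j : Fin m, i ≠ j → Disjoint (J i) (J j))
    (hJunion : (⋃ j, J j) = Set.Icc a b)
    (hJorder : ∀ i j : Fin m, i < j → ∀ x ∈ J i, ∀ y ∈ J j, x ≤ y)
    (hJmass : ∀ j, ν₀ (J j) = ν₀ (Set.Icc a b) / m)
    (μ : ℝ) (hμ : μ = (ν₀ (Set.Icc a b)).toReal / m) (hμpos : 0 < μ)
    (xstar : Fin m → ℝ) (hxstar : ∀ j, xstar j = (∫ x in J j, x ∂ν₀) / μ)
    (ℓ : ℝ)
    (hℓ : ℓ = Finset.univ.sup' (Finset.univ_nonempty_iff.mpr ⟨⟨0, by omega⟩⟩)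
      fun j => Metric.diam (J j))
    (f f' : ℝ → ℝ)
    (hderiv : ∀ x ∈ Set.Icc a b, HasDerivWithinAt f (f' x) (Set.Icc a b) x)
    (hf'M : ∀ x ∈ Set.Icc a b, |f' x| ≤ M)
    (hHolder : ∀ x ∈ Set.Icc a b, ∀ y ∈ Set.Icc a b, |f' x - f' y| ≤ K * |x - y| ^ γ)
    (νJ : Fin m → ℝ) (hνJ : ∀ j, νJ j = ∫ x in J j, f x ∂ν₀)
    (fhat : ℝ → ℝ)
    (hfhat1 : ∀ x ∈ Set.Icc a b, x ≤ xstar ⟨0, by omega⟩ →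
      fhat x = νJ ⟨0, by omega⟩ / μ)
    (hfhat2 : ∀ (j : ℕ) (hj : j + 1 < m),
      ∀ x ∈ Set.Ioc (xstar ⟨j, by omega⟩) (xstar ⟨j + 1, hj⟩),
      fhat x = (νJ ⟨j + 1, hj⟩ * (x - xstar ⟨j, by omega⟩)
          + νJ ⟨j, by omega⟩ * (xstar ⟨j + 1, hj⟩ - x))
        / (μ * (xstar ⟨j + 1, hj⟩ - xstar ⟨j, by omega⟩)))
    (hfhat3 : ∀ x ∈ Set.Icc a b, xstar ⟨m - 1, by omega⟩ < x →
      fhat x = νJ ⟨m - 1, by omega⟩ / μ) :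
    ∫ x in Set.Icc a b, (f x - fhat x) ^ 2 ∂ν₀
      ≤ 2 * μ * (M * ℓ + 5 * K * ℓ ^ (1 + γ)) ^ 2
        + 25 * K ^ 2 * (ν₀ (Set.Icc a b)).toReal * ℓ ^ (2 + 2 * γ) := by
  have hJsub : ∀ j, J j ⊆ Set.Icc a b := fun j => hJunion ▸ Set.subset_iUnion J j
  have hcover : ∀ x ∈ Set.Icc a b, ∃ j, x ∈ J j := fun x hx => by
    rw [← hJunion] at hx
    exact Set.mem_iUnion.mp hx
  have hJmeas : ∀ j, MeasurableSet (J j) := fun j => (hJint j).measurableSet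
  have hmass : ∀ j, ν₀.real (J j) = μ := fun j => by
    rw [measureReal_def, hJmass, hμ, ENNReal.toReal_div, ENNReal.toReal_natCast]
  have hdist : ∀ j, ∀ x ∈ J j, ∀ y ∈ J j, |x - y| ≤ ℓ := fun j x hx y hy => by
    have h1 : dist x y ≤ Metric.diam (J j) :=
      Metric.dist_le_diam_of_mem ((Metric.isBounded_Icc a b).subset (hJsub j)) hx hy
    have h2 : Metric.diam (J j) ≤ ℓ := by
      rw [hℓ]
      exact Finset.le_sup' (fun j => Metric.diam (J j)) (Finset.mem_univ j)
    exact (Real.dist_eq x y ▸ h1).trans h2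
  have hfcont : ContinuousOn f (Set.Icc a b) := fun x hx => (hderiv x hx).continuousWithinAt
  have hfint : ∀ j, IntegrableOn f (J j) ν₀ := fun j =>
    hfcont.integrableOn_Icc.mono_set (hJsub j)
  have hidint : ∀ j, IntegrableOn (fun x : ℝ => x) (J j) ν₀ := fun j =>
    (continuousOn_id.integrableOn_Icc (a := a) (b := b)).mono_set (hJsub j)
  have hstar_le : ∀ j c, (∀ y ∈ J j, y ≤ c) → xstar j ≤ c := fun j c h => by
    rw [hxstar]
    exact setIntegral_div_le_of_forall_le (hJmeas j) hμpos (hmass j) (hidint j) h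
  have hle_star : ∀ j c, (∀ y ∈ J j, c ≤ y) → c ≤ xstar j := fun j c h => by
    rw [hxstar]
    exact le_setIntegral_div_of_forall_le (hJmeas j) hμpos (hmass j) (hidint j) h
  have hstar_mem : ∀ j, xstar j ∈ Set.Icc a b := fun j =>
    ⟨hle_star j a fun y hy => (hJsub j hy).1, hstar_le j b fun y hy => (hJsub j hy).2⟩
  have hstar_dist : ∀ j, ∀ y ∈ J j, |y - xstar j| ≤ ℓ := fun j y hy => by
    have h1 : xstar j ≤ y + ℓ := hstar_le j _ fun z hz => by
      linarith [(abs_le.mp (hdist j y hy z hz)).1]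
    have h2 : y - ℓ ≤ xstar j := hle_star j _ fun z hz => by
      linarith [(abs_le.mp (hdist j y hy z hz)).2]
    rw [abs_le]
    constructor <;> linarith
  have hadj : ∀ (j : ℕ) (hj : j + 1 < m),
      xstar ⟨j + 1, hj⟩ - xstar ⟨j, by omega⟩ ≤ 2 * ℓ := fun j hj => by
    have key : ∀ y ∈ J ⟨j, by omega⟩, ∀ z ∈ J ⟨j + 1, hj⟩, z - y ≤ 2 * ℓ := by
      intro y hy z hz
      by_contra! hlt
      have hyz : y ≤ z := hJorder _ _ (by simp [Fin.lt_def]) y hy z hz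
      have hyI := hJsub _ hy
      have hzI := hJsub _ hz
      have hne : y < z := by
        have : 0 ≤ ℓ := (abs_nonneg _).trans (hdist _ y hy y hy)
        linarith
      obtain ⟨i, hi⟩ := hcover ((y + z) / 2) ⟨by linarith [hyI.1], by linarith [hzI.2]⟩
      rcases lt_trichotomy i ⟨j, by omega⟩ with h | h | h
      · linarith [hJorder _ _ h _ hi _ hy]
      · subst h
        linarith [(abs_le.mp (hdist _ _ hi _ hy)).2]
      · rcases lt_trichotomy i ⟨j + 1, hj⟩ with h' | h' | h'
        · simp only [Fin.lt_def] at h h'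
          omega
        · subst h'
          linarith [(abs_le.mp (hdist _ _ hz _ hi)).2]
        · linarith [hJorder _ _ h' _ hz _ hi]
    have h1 : ∀ y ∈ J ⟨j, by omega⟩, xstar ⟨j + 1, hj⟩ - 2 * ℓ ≤ y := fun y hy => by
      have := hstar_le ⟨j + 1, hj⟩ (y + 2 * ℓ) fun z hz => by linarith [key y hy z hz]
      linarith
    linarith [hle_star _ _ h1]
  have hne : ∀ j, (J j).Nonempty := fun j => by
    rw [Set.nonempty_iff_ne_empty]
    intro h
    have := hmass j
    rw [h, measureReal_empty] at this
    linarith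
  have hℓ0 : 0 ≤ ℓ := by
    obtain ⟨y, hy⟩ := hne ⟨0, by omega⟩
    exact (abs_nonneg _).trans (hdist _ y hy y hy)
  have htaylor := fun x hx y hy =>
    abs_sub_sub_deriv_mul_le_of_holder (x := x) (y := y) hγ0 hK hderiv hHolder hx hy
  set E : ℝ := K * ℓ ^ (1 + γ) with hE
  have hE0 : 0 ≤ E := by positivity
  have havg : ∀ j, |νJ j / μ - f (xstar j)| ≤ E := fun j => by
    have hpt : ∀ y ∈ J j, |f y - f (xstar j) - f' (xstar j) * (y - xstar j)| ≤ E := fun y hy =>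
      (htaylor y (hJsub j hy) _ (hstar_mem j)).trans (by
        rw [hE]
        gcongr
        exact hstar_dist j y hy)
    have hlin : IntegrableOn (fun y => f' (xstar j) * (y - xstar j)) (J j) ν₀ :=
      ((hidint j).sub (integrableOn_const (measure_ne_top _ _))).const_mul _
    have hint : IntegrableOn (fun y => f y - f' (xstar j) * (y - xstar j)) (J j) ν₀ :=
      (hfint j).sub hlin
    have hval : (∫ y in J j, (f y - f' (xstar j) * (y - xstar j)) ∂ν₀) / μ = νJ j / μ := by
      rw [integral_sub (hfint j) hlin, integral_const_mul,
        integral_sub (hidint j) (integrableOn_const (measure_ne_top _ _)), setIntegral_const,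
        hmass, ← hνJ]
      have : ∫ y in J j, y ∂ν₀ = μ * xstar j := by
        rw [hxstar]
        field_simp
      rw [this, smul_eq_mul, sub_self, mul_zero, sub_zero]
    have h1 := setIntegral_div_le_of_forall_le (hJmeas j) hμpos (hmass j) hint
      (c := f (xstar j) + E) fun y hy => by linarith [(abs_le.mp (hpt y hy)).2]
    have h2 := le_setIntegral_div_of_forall_le (hJmeas j) hμpos (hmass j) hint
      (c := f (xstar j) - E) fun y hy => by linarith [(abs_le.mp (hpt y hy)).1]
    rw [hval] at h1 h2
    rw [abs_le]
    constructor <;> linarith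
  have haffine : ∀ j, ∀ x ∈ Set.Icc a b, |xstar j - x| ≤ 2 * ℓ →
      |νJ j / μ - f x - f' x * (xstar j - x)| ≤ 5 * E := fun j x hx hd => by
    have h1 : |f (xstar j) - f x - f' x * (xstar j - x)| ≤ 4 * E := by
      refine (htaylor _ (hstar_mem j) x hx).trans ?_
      calc K * |xstar j - x| ^ (1 + γ) ≤ K * (2 * ℓ) ^ (1 + γ) := by gcongr
        _ = 2 ^ (1 + γ) * E := by
            rw [Real.mul_rpow (by norm_num) hℓ0, hE]
            ring
        _ ≤ 2 ^ (2 : ℝ) * E := by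
            gcongr
            · norm_num
            · linarith
        _ = 4 * E := by norm_num
    have h2 := abs_le.mp (havg j)
    rw [abs_le] at h1 ⊢
    constructor <;> linarith
  have hlip : ∀ j, ∀ x ∈ J j, |f x - νJ j / μ| ≤ M * ℓ := fun j x hx => by
    have hpt : ∀ y ∈ J j, |f y - f x| ≤ M * ℓ := fun y hy => by
      have := (convex_Icc a b).norm_image_sub_le_of_norm_hasDerivWithin_le hderiv
        (fun t ht => hf'M t ht) (hJsub j hx) (hJsub j hy)
      simp only [Real.norm_eq_abs] at this
      exact this.trans (by gcongr; exact hdist j y hy x hx)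
    have h1 := setIntegral_div_le_of_forall_le (hJmeas j) hμpos (hmass j) (hfint j)
      (c := f x + M * ℓ) fun y hy => by linarith [(abs_le.mp (hpt y hy)).2]
    have h2 := le_setIntegral_div_of_forall_le (hJmeas j) hμpos (hmass j) (hfint j)
      (c := f x - M * ℓ) fun y hy => by linarith [(abs_le.mp (hpt y hy)).1]
    rw [← hνJ] at h1 h2
    rw [abs_le]
    constructor <;> linarith
  set first : Fin m := ⟨0, by omega⟩
  set last : Fin m := ⟨m - 1, by omega⟩
  set A : ℝ := M * ℓ + 5 * E with hA
  have hA0 : 0 ≤ M * ℓ := by positivity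
  have herr : ∀ x ∈ Set.Icc a b,
      ((x ∈ J first ∨ x ∈ J last) ∧ |f x - fhat x| ≤ A) ∨ |f x - fhat x| ≤ 5 * E := by
    intro x hx
    rcases le_or_gt x (xstar first) with h1 | h1
    · rw [hfhat1 x hx h1]
      obtain ⟨i, hi⟩ := hcover x hx
      by_cases hi0 : i = first
      · subst hi0
        exact Or.inl ⟨Or.inl hi, (hlip _ x hi).trans (by linarith)⟩
      · have hlt : first < i := by
          rw [Fin.lt_def]
          have : i.val ≠ 0 := fun h => hi0 (Fin.ext h)
          exact Nat.pos_of_ne_zero this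
        have hge : xstar first ≤ x := hstar_le _ _ fun y hy => hJorder _ _ hlt y hy x hi
        right
        rw [le_antisymm h1 hge, abs_sub_comm]
        exact (havg first).trans (by linarith)
    rcases lt_or_ge (xstar last) x with h2 | h2
    · rw [hfhat3 x hx h2]
      obtain ⟨i, hi⟩ := hcover x hx
      by_cases hi0 : i = last
      · subst hi0
        exact Or.inl ⟨Or.inr hi, (hlip _ x hi).trans (by linarith)⟩
      · have hlt : i < last := by
          have : i.val ≠ m - 1 := fun h => hi0 (Fin.ext h)
          have := i.isLt
          rw [Fin.lt_def]
          change i.val < m - 1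
          omega
        exact absurd (hle_star _ _ fun y hy => hJorder _ _ hlt x hi y hy) (not_le.mpr h2)
    · obtain ⟨j, hj, hxj⟩ := exists_mem_Ioc_consecutive
        (fun k => if hk : k < m then xstar ⟨k, hk⟩ else 0) (m - 1)
        (by simpa [show 0 < m by omega] using h1) (by simpa [show m - 1 < m by omega] using h2)
      have hj1 : j + 1 < m := by omega
      simp only [hj1, show j < m by omega, dif_pos] at hxj
      right
      have hd := hadj j hj1
      rw [hfhat2 j hj1 x hxj]
      have := abs_sub_interpolation_le hxj.1 hxj.2
        (haffine ⟨j + 1, hj1⟩ x hx (by rw [abs_le]; constructor <;> linarith [hxj.1, hxj.2]))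
        (haffine ⟨j, by omega⟩ x hx (by rw [abs_le]; constructor <;> linarith [hxj.1, hxj.2]))
      convert this using 3
      have hpq : xstar ⟨j + 1, hj1⟩ - xstar ⟨j, by omega⟩ ≠ 0 := by linarith [hxj.1, hxj.2]
      field_simp
  have hind : ∀ j, Integrable ((J j).indicator fun _ => A ^ 2) (ν₀.restrict (Set.Icc a b)) :=
    fun j => (integrable_const _).indicator (hJmeas j)
  have hindval : ∀ j, ∫ x in Set.Icc a b, (J j).indicator (fun _ => A ^ 2) x ∂ν₀ = μ * A ^ 2 :=
    fun j => by
      rw [setIntegral_indicator (hJmeas j), Set.inter_eq_self_of_subset_right (hJsub j),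
        setIntegral_const, hmass, smul_eq_mul]
  calc ∫ x in Set.Icc a b, (f x - fhat x) ^ 2 ∂ν₀
      ≤ ∫ x in Set.Icc a b, ((J first).indicator (fun _ => A ^ 2) x
          + (J last).indicator (fun _ => A ^ 2) x + (5 * E) ^ 2) ∂ν₀ := by
        refine integral_mono_of_nonneg (Filter.Eventually.of_forall fun x => sq_nonneg _)
          (((hind first).add (hind last)).add (integrable_const _)) ?_
        filter_upwards [ae_restrict_mem measurableSet_Icc] with x hx
        have hn : ∀ j, 0 ≤ (J j).indicator (fun _ => A ^ 2) x := fun j =>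
          Set.indicator_nonneg (fun _ _ => sq_nonneg A) x
        have hn1 := hn first
        have hn2 := hn last
        have hE2 := sq_nonneg (5 * E)
        rcases herr x hx with ⟨h | h, hle⟩ | hle
        · have := sq_le_sq' (abs_le.mp hle).1 (abs_le.mp hle).2
          rw [Set.indicator_of_mem h]
          linarith
        · have := sq_le_sq' (abs_le.mp hle).1 (abs_le.mp hle).2
          rw [Set.indicator_of_mem h]
          linarith
        · have := sq_le_sq' (abs_le.mp hle).1 (abs_le.mp hle).2
          linarith
    _ = μ * A ^ 2 + μ * A ^ 2 + (ν₀ (Set.Icc a b)).toReal * (5 * E) ^ 2 := by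
        rw [integral_add (by exact (hind first).add (hind last)) (integrable_const _),
          integral_add (hind first) (hind last), hindval, hindval, setIntegral_const,
          smul_eq_mul, measureReal_def]
    _ = 2 * μ * (M * ℓ + 5 * K * ℓ ^ (1 + γ)) ^ 2
        + 25 * K ^ 2 * (ν₀ (Set.Icc a b)).toReal * ℓ ^ (2 + 2 * γ) := by
        have hpow : ℓ ^ (2 + 2 * γ) = (ℓ ^ (1 + γ)) ^ 2 := by
          rw [← Real.rpow_natCast, ← Real.rpow_mul hℓ0]
          congr 1
          push_cast
          ring
        rw [hpow, hA, hE]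
        ring
end

section
/- Let J and J′ be two adjacent bounded intervals in ℝ (J′ lying immediately to the right of J), let ν₀ be a finite Borel measure with ν₀(J) > 0 and ν₀(J′) > 0, and let x*, x′* be the ν₀-barycenters of J and J′ respectively (so x* < x′*). Let a := (1/ν₀(J)) ∫_J f dν₀ and a′ := (1/ν₀(J′)) ∫_{J′} f dν₀, and for x ∈ (x*, x′*] define the linear interpolation L(x) := [a′ (x − x*) + a (x′* − x)] / (x′* − x*). If f is differentiable on J ∪ J′ with |f′(u) − f′(v)| ≤ K|u − v|^γ for all u, v ∈ J ∪ J′ (γ ∈ (0,1], K > 0), then for every x ∈ (x*, x′*], |f(x) − L(x)| ≤ K ℓ^{1+γ} + K (2ℓ)^{1+γ}, where ℓ := max(diam J, diam J′). -/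
open MeasureTheory

/-- First-order Taylor estimate for a function with Hölder derivative on an interval. -/
theorem abs_taylor_remainder_le_of_holder_deriv {I : Set ℝ} (hI : I.OrdConnected) {f f' : ℝ → ℝ}
    {K γ : ℝ} (hγ : 0 < γ) (hK : 0 < K)
    (hderiv : ∀ x ∈ I, HasDerivWithinAt f (f' x) I x)
    (hHolder : ∀ x ∈ I, ∀ y ∈ I, |f' x - f' y| ≤ K * |x - y| ^ γ)
    {c u d : ℝ} (hc : c ∈ I) (hu : u ∈ I) (hd : |u - c| ≤ d) :
    |f u - f c - f' c * (u - c)| ≤ K * d ^ (1 + γ) := by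
  have hsub : Set.uIcc c u ⊆ I := hI.uIcc_subset hc hu
  have hd0 : 0 ≤ d := (abs_nonneg _).trans hd
  have hmvt := (convex_uIcc c u).norm_image_sub_le_of_norm_hasDerivWithin_le
    (f := fun x => f x - f' c * x) (f' := fun x => f' x - f' c) (C := K * d ^ γ)
    (fun x hx => by
      have hlin := ((hasDerivAt_id x).const_mul (f' c)).hasDerivWithinAt (s := Set.uIcc c u)
      exact (((hderiv x (hsub hx)).mono hsub).sub hlin).congr_deriv (by simp))
    (fun x hx => by
      refine (hHolder x (hsub hx) c hc).trans ?_
      have hxc : |x - c| ≤ d := (Set.abs_sub_left_of_mem_uIcc hx).trans hd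
      gcongr)
    Set.left_mem_uIcc Set.right_mem_uIcc
  rw [Real.norm_eq_abs, Real.norm_eq_abs] at hmvt
  rw [Real.rpow_add' hd0 (by linarith), Real.rpow_one]
  calc |f u - f c - f' c * (u - c)| = |f u - f' c * u - (f c - f' c * c)| := by
        congr 1; ring
    _ ≤ K * d ^ γ * |u - c| := hmvt
    _ ≤ K * d ^ γ * d := by gcongr
    _ = K * (d * d ^ γ) := by ring

/-- The identity function is integrable on a bounded set for a finite measure. -/
theorem integrableOn_id_of_isBounded {J : Set ℝ} (hJm : MeasurableSet J)
    (hJb : Bornology.IsBounded J) (ν : Measure ℝ) [IsFiniteMeasure ν] :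
    IntegrableOn (fun x : ℝ => x) J ν := by
  obtain ⟨C, hC⟩ := hJb.exists_norm_le
  exact Measure.integrableOn_of_bounded (measure_ne_top _ _)
    measurable_id.aestronglyMeasurable ((ae_restrict_iff' hJm).2 (.of_forall hC))

/-- The barycenter of a bounded interval of positive measure belongs to the interval. -/
theorem barycenter_mem {J : Set ℝ} (hJ : J.OrdConnected) (hJb : Bornology.IsBounded J)
    (ν : Measure ℝ) [IsFiniteMeasure ν] (hpos : 0 < ν J) :
    (∫ x in J, x ∂ν) / (ν J).toReal ∈ J := by
  have hint := integrableOn_id_of_isBounded hJ.measurableSet hJb ν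
  obtain ⟨u, hu, hu'⟩ := exists_le_setAverage hpos.ne' (measure_ne_top _ _) hint
  obtain ⟨v, hv, hv'⟩ := exists_setAverage_le hpos.ne' (measure_ne_top _ _) hint
  rw [setAverage_eq, smul_eq_mul, inv_mul_eq_div] at hu' hv'
  exact hJ.out hu hv ⟨hu', hv'⟩

/-- Averaging a function over an interval agrees with evaluating it at the barycenter, up to the
bound on the first-order Taylor remainder. -/
theorem abs_average_sub_apply_barycenter_le {J : Set ℝ} (hJ : J.OrdConnected)
    (hJb : Bornology.IsBounded J) (ν : Measure ℝ) [IsFiniteMeasure ν] (hpos : 0 < ν J)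
    {f : ℝ → ℝ} (hf : ContinuousOn f J) {c m C : ℝ}
    (hc : c = (∫ x in J, x ∂ν) / (ν J).toReal)
    (hC : ∀ u ∈ J, |f u - f c - m * (u - c)| ≤ C) :
    |(∫ x in J, f x ∂ν) / (ν J).toReal - f c| ≤ C := by
  have hJm := hJ.measurableSet
  have hν : 0 < (ν J).toReal := ENNReal.toReal_pos hpos.ne' (measure_ne_top _ _)
  have hid := integrableOn_id_of_isBounded hJm hJb ν
  have hlin : IntegrableOn (fun u => m * u + (f c - m * c)) J ν :=
    (hid.const_mul m).add (integrableOn_const (measure_ne_top _ _))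
  have hrem : IntegrableOn (fun u => f u - f c - m * (u - c)) J ν :=
    .of_bound (measure_lt_top _ _)
      (ContinuousOn.aestronglyMeasurable (f := fun u => f u - f c - m * (u - c))
        (by fun_prop) hJm) C
      ((ae_restrict_iff' hJm).2 (.of_forall hC))
  have hsum : ∫ u in J, f u ∂ν
      = (∫ u in J, (f u - f c - m * (u - c)) ∂ν) + ∫ u in J, (m * u + (f c - m * c)) ∂ν := by
    rw [← integral_add hrem hlin]
    congr 1 with u
    ring
  have hlin_eq : ∫ u in J, (m * u + (f c - m * c)) ∂ν = f c * (ν J).toReal := by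
    rw [integral_add (hid.const_mul m) (integrableOn_const (measure_ne_top _ _)),
      integral_const_mul, setIntegral_const, smul_eq_mul, Measure.real,
      show ∫ x in J, x ∂ν = c * (ν J).toReal by rw [hc]; field_simp]
    ring
  have hbound := norm_setIntegral_le_of_norm_le_const
    (f := fun u => f u - f c - m * (u - c)) (measure_lt_top ν J) hC
  rw [hsum, hlin_eq, add_div, mul_div_cancel_right₀ _ hν.ne', add_sub_cancel_right, abs_div,
    abs_of_pos hν, div_le_iff₀ hν]
  exact hbound

/-- Points of two adjacent bounded intervals are at distance at most the sum of the diameters. -/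
theorem abs_sub_le_diam_add_diam {J J' : Set ℝ} (hJb : Bornology.IsBounded J)
    (hJ'b : Bornology.IsBounded J') (h : sSup J = sInf J') {x y : ℝ} (hx : x ∈ J) (hy : y ∈ J') :
    |y - x| ≤ Metric.diam J + Metric.diam J' := by
  have hm : sSup J ∈ closure J := csSup_mem_closure ⟨x, hx⟩ hJb.bddAbove
  have hm' : sSup J ∈ closure J' := h ▸ csInf_mem_closure ⟨y, hy⟩ hJ'b.bddBelow
  have h₁ := Metric.dist_le_diam_of_mem hJb.closure hm (subset_closure hx)
  have h₂ := Metric.dist_le_diam_of_mem hJ'b.closure (subset_closure hy) hm'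
  rw [Metric.diam_closure] at h₁ h₂
  rw [← Real.dist_eq]
  linarith [dist_triangle y (sSup J) x]

/-- Error bound for the linear interpolation of approximate nodal values, given bounds on the
nodal errors and on the first-order Taylor remainders at the evaluation point. -/
theorem abs_sub_interpolation_le_s3 {p q x a b fp fq y m A B : ℝ} (hp : p < x) (hq : x ≤ q)
    (ha : |a - fp| ≤ A) (hb : |b - fq| ≤ A)
    (hfp : |fp - y - m * (p - x)| ≤ B) (hfq : |fq - y - m * (q - x)| ≤ B) :
    |y - (b * (x - p) + a * (q - x)) / (q - p)| ≤ A + B := by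
  have hpq : 0 < q - p := by linarith
  have hx : 0 ≤ x - p := by linarith
  have hx' : 0 ≤ q - x := by linarith
  rw [abs_le] at ha hb hfp hfq
  rw [abs_sub_comm, abs_le, show (b * (x - p) + a * (q - x)) / (q - p) - y
      = ((b - y) * (x - p) + (a - y) * (q - x)) / (q - p) by field_simp; ring]
  rw [le_div_iff₀ hpq, div_le_iff₀ hpq]
  constructor
  · nlinarith
  · nlinarith

/-- Let `J, J'` be adjacent bounded intervals (`J ∪ J'` is an interval and
`sup J = inf J'`), with `ν₀ J > 0 < ν₀ J'`, barycenters `x*` and `x'*`, and cell averages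
`a = (∫_J f dν₀)/ν₀ J`, `a' = (∫_{J'} f dν₀)/ν₀ J'`. If `f` is differentiable on `J ∪ J'`
with `γ`-Hölder derivative (constant `K`), then the linear interpolation
`L x = (a' (x - x*) + a (x'* - x))/(x'* - x*)` satisfies, for every `x ∈ (x*, x'*]`,
`|f x - L x| ≤ K ℓ^{1+γ} + K (2ℓ)^{1+γ}` where `ℓ = max (diam J) (diam J')`. -/
theorem stmt_3 (J J' : Set ℝ)
    (hJ : J.OrdConnected) (hJ' : J'.OrdConnected)
    (hJb : Bornology.IsBounded J) (hJ'b : Bornology.IsBounded J')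
    (hadj : (J ∪ J').OrdConnected) (hsupinf : sSup J = sInf J')
    (ν₀ : Measure ℝ) [IsFiniteMeasure ν₀]
    (hJpos : 0 < ν₀ J) (hJ'pos : 0 < ν₀ J')
    (γ K : ℝ) (hγ0 : 0 < γ) (hγ1 : γ ≤ 1) (hK : 0 < K)
    (f f' : ℝ → ℝ)
    (hderiv : ∀ x ∈ J ∪ J', HasDerivWithinAt f (f' x) (J ∪ J') x)
    (hHolder : ∀ x ∈ J ∪ J', ∀ y ∈ J ∪ J', |f' x - f' y| ≤ K * |x - y| ^ γ)
    (xs xs' aJ aJ' ℓ : ℝ)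
    (hxs : xs = (∫ x in J, x ∂ν₀) / (ν₀ J).toReal)
    (hxs' : xs' = (∫ x in J', x ∂ν₀) / (ν₀ J').toReal)
    (haJ : aJ = (∫ x in J, f x ∂ν₀) / (ν₀ J).toReal)
    (haJ' : aJ' = (∫ x in J', f x ∂ν₀) / (ν₀ J').toReal)
    (hℓ : ℓ = max (Metric.diam J) (Metric.diam J')) :
    ∀ x, xs < x → x ≤ xs' →
      |f x - (aJ' * (x - xs) + aJ * (xs' - x)) / (xs' - xs)|
        ≤ K * ℓ ^ (1 + γ) + K * (2 * ℓ) ^ (1 + γ) := by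
  intro x hx hx'
  have hxsJ : xs ∈ J := hxs ▸ barycenter_mem hJ hJb ν₀ hJpos
  have hxsJ' : xs' ∈ J' := hxs' ▸ barycenter_mem hJ' hJ'b ν₀ hJ'pos
  have hxsI : xs ∈ J ∪ J' := Or.inl hxsJ
  have hxsI' : xs' ∈ J ∪ J' := Or.inr hxsJ'
  have hxI : x ∈ J ∪ J' := hadj.out hxsI hxsI' ⟨hx.le, hx'⟩
  have hcont : ContinuousOn f (J ∪ J') := fun u hu => (hderiv u hu).continuousWithinAt
  have hdist : xs' - xs ≤ 2 * ℓ := by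
    have h := (le_abs_self _).trans (abs_sub_le_diam_add_diam hJb hJ'b hsupinf hxsJ hxsJ')
    have h₁ := le_max_left (Metric.diam J) (Metric.diam J')
    have h₂ := le_max_right (Metric.diam J) (Metric.diam J')
    linarith
  have taylor {c u d : ℝ} (hc : c ∈ J ∪ J') (hu : u ∈ J ∪ J') (hd : |u - c| ≤ d) :=
    abs_taylor_remainder_le_of_holder_deriv hadj hγ0 hK hderiv hHolder hc hu hd
  refine abs_sub_interpolation_le_s3 (fp := f xs) (fq := f xs') (m := f' x) hx hx' ?_ ?_
    (taylor hxI hxsI ?_) (taylor hxI hxsI' ?_)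
  · rw [haJ]
    exact abs_average_sub_apply_barycenter_le hJ hJb ν₀ hJpos
      (hcont.mono Set.subset_union_left) hxs fun u hu => taylor hxsI (Or.inl hu) <|
        (Metric.dist_le_diam_of_mem hJb hu hxsJ).trans (hℓ ▸ le_max_left _ _)
  · rw [haJ']
    exact abs_average_sub_apply_barycenter_le hJ' hJ'b ν₀ hJ'pos
      (hcont.mono Set.subset_union_right) hxs' fun u hu => taylor hxsI' (Or.inr hu) <|
        (Metric.dist_le_diam_of_mem hJ'b hu hxsJ').trans (hℓ ▸ le_max_right _ _)
  · rw [abs_le]; constructor <;> linarith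
  · rw [abs_le]; constructor <;> linarith
end

section
/- Let I ⊆ ℝ be a compact interval, ν₀ a finite Borel measure on I, and J₁, …, J_m a partition of I into intervals with ν₀(J_j) > 0 for every j; let ℓ := max_j diam(J_j). Let κ, M > 0 and suppose f : I → ℝ is differentiable with f(x) ≥ κ and |f′(x)| ≤ M for all x ∈ I. Then ∑_{j=1}^m ( (1/√(ν₀(J_j))) ∫_{J_j} √f dν₀ − √(∫_{J_j} f dν₀) )² ≤ (M⁴ / (16 κ³)) ν₀(I) ℓ⁴. -/
open MeasureTheory

/-- A quantitative form of the Cauchy–Schwarz inequality `∫ g ≤ √μ(S) √(∫ g²)` for a function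
which is bounded below by `c > 0` and oscillates by at most `D` on `S`. -/
theorem sq_setIntegral_div_sqrt_sub_sqrt_le {α : Type*} [MeasurableSpace α] {μ : Measure α}
    [IsFiniteMeasure μ] {S : Set α} (hS : MeasurableSet S) (hpos : 0 < μ S) {g : α → ℝ} {c D : ℝ}
    (hc : 0 < c) (hg : IntegrableOn g S μ) (hg2 : IntegrableOn (fun x => g x ^ 2) S μ)
    (hcg : ∀ x ∈ S, c ≤ g x) (hD : ∀ x ∈ S, ∀ y ∈ S, |g x - g y| ≤ D) :
    ((∫ x in S, g x ∂μ) / √(μ.real S) - √(∫ x in S, g x ^ 2 ∂μ)) ^ 2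
      ≤ μ.real S * (D ^ 4 / (4 * c ^ 2)) := by
  have hp : 0 < μ.real S := ENNReal.toReal_pos hpos.ne' (measure_ne_top μ S)
  obtain ⟨y, hy⟩ := nonempty_of_measure_ne_zero hpos.ne'
  have hconst : ∀ t : ℝ, IntegrableOn (fun _ => t) S μ := fun t => integrableOn_const
  have expand : ∀ t : ℝ, ∫ x in S, (g x - t) ^ 2 ∂μ
      = (∫ x in S, g x ^ 2 ∂μ) - 2 * t * (∫ x in S, g x ∂μ) + t ^ 2 * μ.real S := by
    intro t
    have h : ∀ x, (g x - t) ^ 2 = g x ^ 2 - 2 * t * g x + t ^ 2 := fun x => by ring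
    have hdiff : IntegrableOn (fun x => g x ^ 2 - 2 * t * g x) S μ := hg2.sub (hg.const_mul (2 * t))
    simp_rw [h]
    rw [integral_add hdiff (hconst _),
      integral_sub hg2 (hg.const_mul (2 * t)), integral_const_mul, setIntegral_const, smul_eq_mul,
      mul_comm (μ.real S)]
  have hintsq : ∀ t : ℝ, IntegrableOn (fun x => (g x - t) ^ 2) S μ := by
    intro t
    have h : (fun x => (g x - t) ^ 2) = fun x => g x ^ 2 - 2 * t * g x + t ^ 2 := by
      funext x; ring
    rw [h]
    exact (hg2.sub (hg.const_mul (2 * t))).add (hconst _)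
  have hlow : c * μ.real S ≤ ∫ x in S, g x ∂μ := by
    have := setIntegral_mono_on (hconst c) hg hS hcg
    rwa [setIntegral_const, smul_eq_mul, mul_comm] at this
  have hosc : ∫ x in S, (g x - g y) ^ 2 ∂μ ≤ D ^ 2 * μ.real S := by
    have := setIntegral_mono_on (hintsq (g y)) (hconst (D ^ 2)) hS
      (fun x hx => sq_le_sq.2 ((hD x hx y hy).trans (le_abs_self D)))
    rwa [setIntegral_const, smul_eq_mul, mul_comm] at this
  rw [expand] at hosc
  have hvar : 0 ≤ ∫ x in S, (g x - (∫ x in S, g x ∂μ) / μ.real S) ^ 2 ∂μ :=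
    integral_nonneg fun x => sq_nonneg _
  rw [expand] at hvar
  generalize (∫ x in S, g x ∂μ) = A at *
  generalize (∫ x in S, g x ^ 2 ∂μ) = B at *
  generalize μ.real S = p at *
  obtain ⟨s, hs, rfl⟩ : ∃ s : ℝ, 0 < s ∧ p = s ^ 2 :=
    ⟨√p, Real.sqrt_pos.2 hp, (Real.sq_sqrt hp.le).symm⟩
  obtain ⟨u, rfl⟩ : ∃ u : ℝ, A = u * s := ⟨A / s, by field_simp⟩
  rw [Real.sqrt_sq hs.le, mul_div_cancel_right₀ u hs.ne']
  have hcu : c * s ≤ u := by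
    have : c * s * s ≤ u * s := by linarith
    exact le_of_mul_le_mul_right this hs
  have huB : u ^ 2 ≤ B := by
    have : B - 2 * (u * s / s ^ 2) * (u * s) + (u * s / s ^ 2) ^ 2 * s ^ 2 = B - u ^ 2 := by
      field_simp; ring
    linarith
  have hBu : B - u ^ 2 ≤ D ^ 2 * s ^ 2 := by nlinarith [sq_nonneg (g y * s - u)]
  have hcs : 0 < c * s := mul_pos hc hs
  have hv : u ≤ √B := Real.le_sqrt_of_sq_le huB
  have hvB : √B ^ 2 = B := Real.sq_sqrt ((sq_nonneg u).trans huB)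
  have hdiff : √B - u ≤ D ^ 2 * s / (2 * c) := by
    rw [le_div_iff₀ (by positivity)]
    have h : (√B - u) * (2 * c) * s ≤ D ^ 2 * s * s := by
      nlinarith [mul_nonneg (sub_nonneg.2 hv) (by linarith : 0 ≤ √B + u - 2 * (c * s))]
    exact le_of_mul_le_mul_right h hs
  calc (u - √B) ^ 2 = (√B - u) ^ 2 := by ring
    _ ≤ (D ^ 2 * s / (2 * c)) ^ 2 := pow_le_pow_left₀ (sub_nonneg.2 hv) hdiff 2
    _ = s ^ 2 * (D ^ 4 / (4 * c ^ 2)) := by field_simp; ring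

/-- The square root is Lipschitz with constant `1 / (2√κ)` on `[κ, ∞)`. -/
theorem abs_sqrt_sub_sqrt_le {κ u v : ℝ} (hκ : 0 < κ) (hu : κ ≤ u) (hv : κ ≤ v) :
    |√u - √v| ≤ |u - v| / (2 * √κ) := by
  have hs : 0 < √κ := Real.sqrt_pos.2 hκ
  have hsu := Real.sqrt_le_sqrt hu
  have hsv := Real.sqrt_le_sqrt hv
  have h : u - v = (√u - √v) * (√u + √v) := by
    have h1 := Real.sq_sqrt (hκ.le.trans hu)
    have h2 := Real.sq_sqrt (hκ.le.trans hv)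
    linear_combination h2 - h1
  rw [le_div_iff₀ (by positivity), h, abs_mul, abs_of_pos (by linarith : 0 < √u + √v)]
  exact mul_le_mul_of_nonneg_left (by linarith) (abs_nonneg _)

/-- For a partition `J₁, …, J_m` of a compact interval `I` into intervals of
positive `ν₀`-mass with `ℓ := max_j diam (J_j)`, and `f` differentiable with `f ≥ κ` and
`|f′| ≤ M`, one has
`∑_j ((1/√(ν₀ J_j)) ∫_{J_j} √f dν₀ − √(∫_{J_j} f dν₀))² ≤ (M⁴/(16κ³)) ν₀(I) ℓ⁴`. -/
theorem stmt_5 (a b : ℝ) (hab : a ≤ b)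
    (ν₀ : Measure ℝ) [IsFiniteMeasure ν₀]
    (m : ℕ) (hm : 0 < m) (J : Fin m → Set ℝ)
    (hJint : ∀ j, (J j).OrdConnected)
    (hJdisj : ∀ i j : Fin m, i ≠ j → Disjoint (J i) (J j))
    (hJunion : (⋃ j, J j) = Set.Icc a b)
    (hJpos : ∀ j, 0 < ν₀ (J j))
    (ℓ : ℝ)
    (hℓ : ℓ = Finset.univ.sup' (Finset.univ_nonempty_iff.mpr ⟨⟨0, hm⟩⟩)
      fun j => Metric.diam (J j))
    (κ M : ℝ) (hκ : 0 < κ) (hM : 0 < M)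
    (f f' : ℝ → ℝ)
    (hderiv : ∀ x ∈ Set.Icc a b, HasDerivWithinAt f (f' x) (Set.Icc a b) x)
    (hfκ : ∀ x ∈ Set.Icc a b, κ ≤ f x)
    (hf'M : ∀ x ∈ Set.Icc a b, |f' x| ≤ M) :
    ∑ j, ((∫ x in J j, Real.sqrt (f x) ∂ν₀) / Real.sqrt ((ν₀ (J j)).toReal)
        - Real.sqrt (∫ x in J j, f x ∂ν₀)) ^ 2
      ≤ M ^ 4 / (16 * κ ^ 3) * (ν₀ (Set.Icc a b)).toReal * ℓ ^ 4 := by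
  have hsub : ∀ j, J j ⊆ Set.Icc a b := fun j => hJunion ▸ Set.subset_iUnion J j
  have hmeas : ∀ j, MeasurableSet (J j) := fun j => (hJint j).measurableSet
  have hcont : ContinuousOn f (Set.Icc a b) := fun x hx => (hderiv x hx).continuousWithinAt
  have hfint : IntegrableOn f (Set.Icc a b) ν₀ := hcont.integrableOn_compact isCompact_Icc
  have hgint : IntegrableOn (fun x => √(f x)) (Set.Icc a b) ν₀ :=
    hcont.sqrt.integrableOn_compact isCompact_Icc
  have hs : 0 < √κ := Real.sqrt_pos.2 hκ
  have hsq : ∀ x ∈ Set.Icc a b, √(f x) ^ 2 = f x := fun x hx =>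
    Real.sq_sqrt (hκ.le.trans (hfκ x hx))
  have hdiam : ∀ j, Metric.diam (J j) ≤ ℓ := fun j =>
    hℓ ▸ Finset.le_sup' (fun j => Metric.diam (J j)) (Finset.mem_univ j)
  have hosc : ∀ j, ∀ x ∈ J j, ∀ y ∈ J j, |√(f x) - √(f y)| ≤ M * ℓ / (2 * √κ) := by
    intro j x hx y hy
    refine (abs_sqrt_sub_sqrt_le hκ (hfκ x (hsub j hx)) (hfκ y (hsub j hy))).trans ?_
    have hlip := (convex_Icc a b).norm_image_sub_le_of_norm_hasDerivWithin_le
      hderiv hf'M (hsub j hy) (hsub j hx)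
    have hdist : ‖x - y‖ ≤ ℓ := (dist_eq_norm x y) ▸
      (Metric.dist_le_diam_of_mem (Metric.isBounded_Icc a b |>.subset (hsub j)) hx hy).trans
        (hdiam j)
    gcongr
    exact hlip.trans (mul_le_mul_of_nonneg_left hdist hM.le)
  have hterm : ∀ j, ((∫ x in J j, √(f x) ∂ν₀) / √((ν₀ (J j)).toReal)
      - √(∫ x in J j, f x ∂ν₀)) ^ 2 ≤ ν₀.real (J j) * (M ^ 4 / (16 * κ ^ 3) * ℓ ^ 4) := by
    intro j
    have hfg : ∀ x ∈ J j, √(f x) ^ 2 = f x := fun x hx => hsq x (hsub j hx)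
    have h := sq_setIntegral_div_sqrt_sub_sqrt_le (hmeas j) (hJpos j) hs (hgint.mono_set (hsub j))
      ((hfint.mono_set (hsub j)).congr_fun (fun x hx => (hfg x hx).symm) (hmeas j))
      (fun x hx => Real.sqrt_le_sqrt (hfκ x (hsub j hx))) (hosc j)
    rw [setIntegral_congr_fun (hmeas j) hfg] at h
    refine h.trans (mul_le_mul_of_nonneg_left ?_ measureReal_nonneg)
    have hs4 : √κ ^ 4 = κ ^ 2 := by
      rw [show √κ ^ 4 = (√κ ^ 2) ^ 2 by ring, Real.sq_sqrt hκ.le]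
    rw [div_pow, mul_pow, mul_pow, hs4, Real.sq_sqrt hκ.le]
    have heq : M ^ 4 * ℓ ^ 4 / (2 ^ 4 * κ ^ 2) / (4 * κ)
        = M ^ 4 / (16 * κ ^ 3) * ℓ ^ 4 * (1 / 4) := by
      field_simp; ring
    have : 0 ≤ M ^ 4 / (16 * κ ^ 3) * ℓ ^ 4 := by positivity
    linarith
  have hmass : ∑ j, ν₀.real (J j) = (ν₀ (Set.Icc a b)).toReal := by
    rw [← hJunion, ← measureReal_def,
      measureReal_iUnion_fintype (fun i j hij => hJdisj i j hij) hmeas]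
  refine (Finset.sum_le_sum fun j _ => hterm j).trans (le_of_eq ?_)
  rw [← Finset.sum_mul, hmass]
  ring
end

section
/- Let (X, 𝒜, ξ) be a σ-finite measure space and let P and Q be probability measures on X with densities p and q with respect to ξ. Then for every n ≥ 1 and every measurable set A ⊆ Xⁿ, |P^{⊗n}(A) − Q^{⊗n}(A)| ≤ √( n ∫_X (√(p(x)) − √(q(x)))² ξ(dx) ); that is, the total variation distance between the n-fold product measures is bounded by √n times the Hellinger distance between P and Q. -/
open MeasureTheory

/-- The quadratic form `(u, v) ↦ ∫ (u a + v b)²` is nonnegative, in expanded form. -/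
lemma quadratic_integral_nonneg {Y : Type*} [MeasurableSpace Y] {μ : Measure Y} {a b : Y → ℝ}
    (ha : Integrable (fun y => a y ^ 2) μ) (hb : Integrable (fun y => b y ^ 2) μ)
    (hab : Integrable (fun y => a y * b y) μ) (u v : ℝ) :
    0 ≤ u ^ 2 * ∫ y, a y ^ 2 ∂μ + 2 * u * v * ∫ y, a y * b y ∂μ + v ^ 2 * ∫ y, b y ^ 2 ∂μ := by
  have h : 0 ≤ ∫ y, (u * a y + v * b y) ^ 2 ∂μ := integral_nonneg fun y => sq_nonneg _
  have e : (fun y => (u * a y + v * b y) ^ 2) =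
      fun y => u ^ 2 * a y ^ 2 + 2 * u * v * (a y * b y) + v ^ 2 * b y ^ 2 := by
    ext y; ring
  rwa [e, integral_add (by fun_prop) (by fun_prop), integral_add (by fun_prop) (by fun_prop),
    integral_const_mul, integral_const_mul, integral_const_mul] at h

/-- Le Cam's inequality for the densities `a²` and `b²`: total variation is bounded in terms of
the affinity `∫ a b`. -/
lemma abs_setIntegral_sq_sub_le_sqrt {Y : Type*} [MeasurableSpace Y] {μ : Measure Y} {a b : Y → ℝ}
    (ha : Integrable (fun y => a y ^ 2) μ) (hb : Integrable (fun y => b y ^ 2) μ)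
    (hab : Integrable (fun y => a y * b y) μ)
    (ha1 : ∫ y, a y ^ 2 ∂μ = 1) (hb1 : ∫ y, b y ^ 2 ∂μ = 1) {A : Set Y} (hA : MeasurableSet A) :
    |∫ y in A, a y ^ 2 ∂μ - ∫ y in A, b y ^ 2 ∂μ| ≤ √(2 - 2 * ∫ y, a y * b y ∂μ) := by
  apply Real.abs_le_sqrt
  have key (t : ℝ) : 0 ≤ (2 + 2 * ∫ y, a y * b y ∂μ) * (t * t) +
      4 * (∫ y in A, a y ^ 2 ∂μ - ∫ y in A, b y ^ 2 ∂μ) * t + (2 - 2 * ∫ y, a y * b y ∂μ) := by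
    have h₁ := quadratic_integral_nonneg (μ := μ.restrict A) ha.restrict hb.restrict
      hab.restrict (t + 1) (t - 1)
    have h₂ := quadratic_integral_nonneg (μ := μ.restrict Aᶜ) ha.restrict hb.restrict
      hab.restrict (t - 1) (t + 1)
    rw [setIntegral_compl hA ha, setIntegral_compl hA hb, setIntegral_compl hA hab,
      ha1, hb1] at h₂
    linarith
  have h := discrim_le_zero key
  rw [discrim] at h
  nlinarith [sq_nonneg (1 - ∫ y, a y * b y ∂μ)]

/-- The product of measures with densities `p i` has density `∏ i, p i`. -/
lemma pi_withDensity_ofReal {ι : Type*} [Fintype ι] {X : Type*} [MeasurableSpace X]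
    {ξ : Measure X} [SigmaFinite ξ] {p : X → ℝ} (hp0 : ∀ x, 0 ≤ p x) (hp : Integrable p ξ) :
    (Measure.pi fun _ : ι => ξ.withDensity fun x => ENNReal.ofReal (p x)) =
      (Measure.pi fun _ : ι => ξ).withDensity fun x => ENNReal.ofReal (∏ i, p (x i)) := by
  have := isFiniteMeasure_withDensity_ofReal hp.2
  refine Measure.pi_eq fun s hs => ?_
  rw [withDensity_apply _ (MeasurableSet.univ_pi hs), Measure.restrict_pi_pi,
    ← ofReal_integral_eq_lintegral_ofReal
      (Integrable.fintype_prod (f := fun _ => p) fun i => hp.restrict)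
      (ae_of_all _ fun x => Finset.prod_nonneg fun i _ => hp0 _),
    integral_fintype_prod_eq_prod (fun _ => p),
    ENNReal.ofReal_prod_of_nonneg fun i _ => integral_nonneg hp0]
  refine Finset.prod_congr rfl fun i _ => ?_
  rw [withDensity_apply _ (hs i),
    ofReal_integral_eq_lintegral_ofReal hp.restrict (ae_of_all _ hp0)]

lemma toReal_withDensity_ofReal_apply {Y : Type*} [MeasurableSpace Y] {μ : Measure Y} {f : Y → ℝ}
    (hf0 : ∀ y, 0 ≤ f y) (hf : Integrable f μ) {A : Set Y} (hA : MeasurableSet A) :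
    ((μ.withDensity fun y => ENNReal.ofReal (f y)) A).toReal = ∫ y in A, f y ∂μ := by
  rw [withDensity_apply _ hA,
    ← ofReal_integral_eq_lintegral_ofReal hf.restrict (ae_of_all _ hf0),
    ENNReal.toReal_ofReal (integral_nonneg hf0)]

/-- A nonnegative density of a probability measure is integrable. -/
lemma integrable_of_isProbabilityMeasure_withDensity {Y : Type*} [MeasurableSpace Y]
    {μ : Measure Y} {f : Y → ℝ} (hf : Measurable f) (hf0 : ∀ y, 0 ≤ f y)
    (h : IsProbabilityMeasure (μ.withDensity fun y => ENNReal.ofReal (f y))) :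
    Integrable f μ := by
  refine ⟨hf.aestronglyMeasurable, ?_⟩
  rw [hasFiniteIntegral_iff_ofReal (ae_of_all _ hf0), ← setLIntegral_univ,
    ← withDensity_apply _ MeasurableSet.univ, h.measure_univ]
  exact ENNReal.one_lt_top

/-- If `P, Q` are probability measures with densities `p, q` with respect to
a σ-finite measure `ξ`, then for every `n ≥ 1` the total variation distance between the
`n`-fold product measures is bounded by `√n` times the Hellinger distance between `P` and `Q`:
for every measurable `A ⊆ Xⁿ`,
`|P^{⊗n}(A) - Q^{⊗n}(A)| ≤ √(n ∫ (√p - √q)² dξ)`. -/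
theorem stmt_12 {X : Type*} [MeasurableSpace X] (ξ : Measure X) [SigmaFinite ξ]
    (p q : X → ℝ) (hp : Measurable p) (hq : Measurable q)
    (hp0 : ∀ x, 0 ≤ p x) (hq0 : ∀ x, 0 ≤ q x)
    (P Q : Measure X)
    (hP : P = ξ.withDensity fun x => ENNReal.ofReal (p x))
    (hQ : Q = ξ.withDensity fun x => ENNReal.ofReal (q x))
    [IsProbabilityMeasure P] [IsProbabilityMeasure Q]
    (n : ℕ) (hn : 1 ≤ n)
    (A : Set (Fin n → X)) (hA : MeasurableSet A) :
    |((Measure.pi fun _ : Fin n => P) A).toReal - ((Measure.pi fun _ : Fin n => Q) A).toReal|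
      ≤ Real.sqrt (n * ∫ x, (Real.sqrt (p x) - Real.sqrt (q x)) ^ 2 ∂ξ) := by
  have ip := integrable_of_isProbabilityMeasure_withDensity (μ := ξ) hp hp0
    (hP ▸ ‹IsProbabilityMeasure P›)
  have iq := integrable_of_isProbabilityMeasure_withDensity (μ := ξ) hq hq0
    (hQ ▸ ‹IsProbabilityMeasure Q›)
  subst hP hQ
  have p1 : ∫ x, p x ∂ξ = 1 := by
    rw [← setIntegral_univ, ← toReal_withDensity_ofReal_apply hp0 ip MeasurableSet.univ,
      measure_univ, ENNReal.toReal_one]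
  have q1 : ∫ x, q x ∂ξ = 1 := by
    rw [← setIntegral_univ, ← toReal_withDensity_ofReal_apply hq0 iq MeasurableSet.univ,
      measure_univ, ENNReal.toReal_one]
  have ipq : Integrable (fun x => √(p x) * √(q x)) ξ := by
    refine (ip.add iq).mono' (by fun_prop) (ae_of_all _ fun x => ?_)
    rw [Real.norm_of_nonneg (by positivity), Pi.add_apply]
    nlinarith [Real.sq_sqrt (hp0 x), Real.sq_sqrt (hq0 x), sq_nonneg (√(p x) - √(q x)),
      hp0 x, hq0 x]
  have hellinger : ∫ x, (√(p x) - √(q x)) ^ 2 ∂ξ = 2 - 2 * ∫ x, √(p x) * √(q x) ∂ξ := by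
    have e : (fun x => (√(p x) - √(q x)) ^ 2) =
        fun x => p x + q x - 2 * (√(p x) * √(q x)) := by
      ext x
      rw [sub_sq, Real.sq_sqrt (hp0 x), Real.sq_sqrt (hq0 x)]
      ring
    rw [e, integral_sub (by fun_prop) (by fun_prop), integral_add ip iq, p1, q1,
      integral_const_mul]
    norm_num
  have prod_sqrt_sq {f : X → ℝ} (hf : ∀ x, 0 ≤ f x) :
      (fun y : Fin n → X => (∏ i, √(f (y i))) ^ 2) = fun y => ∏ i, f (y i) := by
    ext y
    rw [← Finset.prod_pow]
    exact Finset.prod_congr rfl fun i _ => Real.sq_sqrt (hf _)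
  have iP := Integrable.fintype_prod (ι := Fin n) (f := fun _ => p) (μ := fun _ => ξ) fun _ => ip
  have iQ := Integrable.fintype_prod (ι := Fin n) (f := fun _ => q) (μ := fun _ => ξ) fun _ => iq
  have iPQ := Integrable.fintype_prod (ι := Fin n) (f := fun _ x => √(p x) * √(q x))
    (μ := fun _ => ξ) fun _ => ipq
  have tv := abs_setIntegral_sq_sub_le_sqrt (μ := Measure.pi fun _ : Fin n => ξ)
    (a := fun y => ∏ i, √(p (y i))) (b := fun y => ∏ i, √(q (y i)))
    (by rwa [prod_sqrt_sq hp0]) (by rwa [prod_sqrt_sq hq0])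
    (by simpa only [Finset.prod_mul_distrib] using iPQ)
    (by rw [prod_sqrt_sq hp0, integral_fintype_prod_eq_pow, p1, one_pow])
    (by rw [prod_sqrt_sq hq0, integral_fintype_prod_eq_pow, q1, one_pow]) hA
  simp only [← Finset.prod_mul_distrib] at tv
  rw [prod_sqrt_sq hp0, prod_sqrt_sq hq0,
    integral_fintype_prod_eq_pow (fun x => √(p x) * √(q x)), Fintype.card_fin] at tv
  rw [pi_withDensity_ofReal hp0 ip, pi_withDensity_ofReal hq0 iq,
    toReal_withDensity_ofReal_apply (fun y => Finset.prod_nonneg fun i _ => hp0 _) iP hA,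
    toReal_withDensity_ofReal_apply (fun y => Finset.prod_nonneg fun i _ => hq0 _) iQ hA,
    hellinger]
  refine tv.trans (Real.sqrt_le_sqrt ?_)
  have affinity_nonneg : 0 ≤ ∫ x, √(p x) * √(q x) ∂ξ := integral_nonneg fun x => by positivity
  have bernoulli := one_add_mul_le_pow
    (show -2 ≤ (∫ x, √(p x) * √(q x) ∂ξ) - 1 by linarith) n
  rw [add_sub_cancel] at bernoulli
  linarith
end

section
/- Let σ > 0, m ≥ 1, and a, b ∈ ℝ^m. Let P := ⊗_{j=1}^m N(a_j, σ²) and Q := ⊗_{j=1}^m N(b_j, σ²) be the product Gaussian measures on ℝ^m with the given means and common variance σ². Then for every Borel set A ⊆ ℝ^m, |P(A) − Q(A)| ≤ (1/(2σ)) √( ∑_{j=1}^m (a_j − b_j)² ). -/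
open MeasureTheory ProbabilityTheory
open scoped ENNReal NNReal

theorem lintegral_fin_nat_prod_eq_prod {n : ℕ} {E : Type*} [MeasurableSpace E]
    {μ : Fin n → Measure E} [∀ i, SigmaFinite (μ i)]
    {f : Fin n → E → ℝ≥0∞} (hf : ∀ i, Measurable (f i)) :
    ∫⁻ x : Fin n → E, ∏ i, f i (x i) ∂(Measure.pi μ) = ∏ i, ∫⁻ x, f i x ∂(μ i) := by
  induction n with
  | zero => simp
  | succ n ih =>
    rw [← ((measurePreserving_piFinSuccAbove μ 0).symm).lintegral_comp_emb
      (MeasurableEquiv.measurableEmbedding _)]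
    simp_rw [MeasurableEquiv.piFinSuccAbove_symm_apply, Fin.insertNthEquiv,
      Fin.prod_univ_succ, Fin.insertNth_zero, Equiv.coe_fn_mk, Fin.cons_succ,
      Fin.zero_succAbove, cast_eq, Fin.cons_zero]
    rw [← ih fun i => hf i.succ]
    exact lintegral_prod_mul (hf 0).aemeasurable
      (Finset.measurable_prod _ fun (i : Fin n) _ =>
        (hf i.succ).comp (measurable_pi_apply i)).aemeasurable

theorem pi_withDensity {n : ℕ} {E : Type*} [MeasurableSpace E]
    {μ : Fin n → Measure E} [∀ i, SigmaFinite (μ i)]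
    {f : Fin n → E → ℝ≥0∞} (hf : ∀ i, Measurable (f i))
    [∀ i, SigmaFinite ((μ i).withDensity (f i))] :
    Measure.pi (fun i => (μ i).withDensity (f i)) =
      (Measure.pi μ).withDensity (fun x => ∏ i, f i (x i)) := by
  refine Measure.pi_eq fun s hs => ?_
  rw [withDensity_apply _ (MeasurableSet.univ_pi hs), Measure.restrict_pi_pi,
    lintegral_fin_nat_prod_eq_prod hf]
  exact Finset.prod_congr rfl fun i _ => (withDensity_apply _ (hs i)).symm

theorem pi_gaussianReal_eq_withDensity {m : ℕ} (a : Fin m → ℝ) {v : ℝ≥0} (hv : v ≠ 0) :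
    (Measure.pi fun j => gaussianReal (a j) v) =
      (volume : Measure (Fin m → ℝ)).withDensity (fun x => ∏ j, gaussianPDF (a j) v (x j)) := by
  have h (j : Fin m) : SigmaFinite ((volume : Measure ℝ).withDensity (gaussianPDF (a j) v)) := by
    rw [← gaussianReal_of_var_ne_zero _ hv]
    infer_instance
  simp_rw [gaussianReal_of_var_ne_zero _ hv]
  exact pi_withDensity fun j => measurable_gaussianPDF (a j) v

theorem sqrt_gaussianPDFReal_mul (a b : ℝ) {v : ℝ≥0} (hv : v ≠ 0) (x : ℝ) :
    gaussianPDFReal a v x ^ (1 / 2 : ℝ) * gaussianPDFReal b v x ^ (1 / 2 : ℝ) =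
      Real.exp (-((a - b) ^ 2 / (8 * v))) * gaussianPDFReal ((a + b) / 2) v x := by
  have hv' : (v : ℝ) ≠ 0 := by exact_mod_cast hv
  rw [← Real.mul_rpow (gaussianPDFReal_nonneg _ _ _) (gaussianPDFReal_nonneg _ _ _),
    ← Real.sqrt_eq_rpow, Real.sqrt_eq_iff_mul_self_eq
      (mul_nonneg (gaussianPDFReal_nonneg _ _ _) (gaussianPDFReal_nonneg _ _ _))
      (mul_nonneg (Real.exp_pos _).le (gaussianPDFReal_nonneg _ _ _))]
  simp only [gaussianPDFReal]
  have hexp : Real.exp (-(x - a) ^ 2 / (2 * v)) * Real.exp (-(x - b) ^ 2 / (2 * v)) =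
      Real.exp (-((a - b) ^ 2 / (8 * v))) ^ 2 *
        Real.exp (-(x - (a + b) / 2) ^ 2 / (2 * v)) ^ 2 := by
    simp only [← Real.exp_nat_mul, ← Real.exp_add]
    congr 1
    push_cast
    field_simp
    ring
  linear_combination (√(2 * Real.pi * v))⁻¹ ^ 2 * hexp

theorem sqrt_gaussianPDF_mul (a b : ℝ) {v : ℝ≥0} (hv : v ≠ 0) (x : ℝ) :
    gaussianPDF a v x ^ (1 / 2 : ℝ) * gaussianPDF b v x ^ (1 / 2 : ℝ) =
      ENNReal.ofReal (Real.exp (-((a - b) ^ 2 / (8 * v)))) * gaussianPDF ((a + b) / 2) v x := by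
  simp only [gaussianPDF]
  rw [ENNReal.ofReal_rpow_of_nonneg (gaussianPDFReal_nonneg _ _ _) (by norm_num),
    ENNReal.ofReal_rpow_of_nonneg (gaussianPDFReal_nonneg _ _ _) (by norm_num),
    ← ENNReal.ofReal_mul (Real.rpow_nonneg (gaussianPDFReal_nonneg _ _ _) _),
    ← ENNReal.ofReal_mul (Real.exp_pos _).le, sqrt_gaussianPDFReal_mul a b hv]

/-- The midpoint Gaussian product measure of a set, scaled by the Hellinger affinity, is at most the
geometric mean of the measures of that set under the two Gaussian product measures. -/
theorem exp_mul_pi_gaussianReal_le {m : ℕ} (a b : Fin m → ℝ) {v : ℝ≥0} (hv : v ≠ 0)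
    {A : Set (Fin m → ℝ)} (hA : MeasurableSet A) :
    Real.exp (-((∑ j, (a j - b j) ^ 2) / (8 * v))) *
        (Measure.pi fun j => gaussianReal ((a j + b j) / 2) v).real A ≤
      √((Measure.pi fun j => gaussianReal (a j) v).real A) *
        √((Measure.pi fun j => gaussianReal (b j) v).real A) := by
  have hmeas (c : Fin m → ℝ) : Measurable fun x : Fin m → ℝ => ∏ j, gaussianPDF (c j) v (x j) :=
    Finset.measurable_prod _ fun j _ =>
      (measurable_gaussianPDF (c j) v).comp (measurable_pi_apply j)
  have key : ENNReal.ofReal (Real.exp (-((∑ j, (a j - b j) ^ 2) / (8 * v)))) *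
      (Measure.pi fun j => gaussianReal ((a j + b j) / 2) v) A ≤
      (Measure.pi fun j => gaussianReal (a j) v) A ^ (1 / 2 : ℝ) *
        (Measure.pi fun j => gaussianReal (b j) v) A ^ (1 / 2 : ℝ) := by
    simp_rw [pi_gaussianReal_eq_withDensity _ hv, withDensity_apply _ hA]
    refine le_trans (le_of_eq ?_) (ENNReal.lintegral_mul_norm_pow_le
      (hmeas a).aemeasurable (hmeas b).aemeasurable (by norm_num) (by norm_num) (by norm_num))
    rw [← lintegral_const_mul _ (hmeas _)]
    refine lintegral_congr fun x => ?_
    rw [← ENNReal.prod_rpow_of_nonneg (by norm_num), ← ENNReal.prod_rpow_of_nonneg (by norm_num),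
      ← Finset.prod_mul_distrib]
    simp_rw [sqrt_gaussianPDF_mul _ _ hv]
    rw [Finset.prod_mul_distrib, ← ENNReal.ofReal_prod_of_nonneg fun _ _ => (Real.exp_pos _).le,
      ← Real.exp_sum, Finset.sum_neg_distrib, Finset.sum_div]
  have h := ENNReal.toReal_mono (by finiteness) key
  rwa [ENNReal.toReal_mul, ENNReal.toReal_mul, ENNReal.toReal_ofReal (Real.exp_pos _).le,
    ← ENNReal.toReal_rpow, ← ENNReal.toReal_rpow, ← Real.sqrt_eq_rpow, ← Real.sqrt_eq_rpow] at h

/-- The affinity of two Bernoulli laws bounds the distance of their parameters. -/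
theorem sq_sub_le_one_sub_sq_affinity {p q : ℝ} (hp₀ : 0 ≤ p) (hp₁ : p ≤ 1) (hq₀ : 0 ≤ q)
    (hq₁ : q ≤ 1) :
    (p - q) ^ 2 ≤ 1 - (√p * √q + √(1 - p) * √(1 - q)) ^ 2 := by
  have h₁ := Real.sq_sqrt hp₀
  have h₂ := Real.sq_sqrt hq₀
  have h₃ := Real.sq_sqrt (sub_nonneg.2 hp₁)
  have h₄ := Real.sq_sqrt (sub_nonneg.2 hq₁)
  generalize √p = s at *
  generalize √q = t at *
  generalize √(1 - p) = c at *
  generalize √(1 - q) = d at *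
  have hsum : (s * t + c * d) ^ 2 + (s * d - t * c) ^ 2 = 1 := by
    linear_combination (t ^ 2 + d ^ 2) * (h₁ + h₃) + (h₂ + h₄)
  have hle : (s * d + t * c) ^ 2 ≤ 1 := by
    have : (s * d + t * c) ^ 2 + (c * d - s * t) ^ 2 = 1 := by
      linear_combination (t ^ 2 + d ^ 2) * (h₁ + h₃) + (h₂ + h₄)
    linarith [sq_nonneg (c * d - s * t)]
  have hprod : p - q = (s * d - t * c) * (s * d + t * c) := by
    linear_combination c ^ 2 * h₂ - d ^ 2 * h₁ + q * h₃ - p * h₄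
  calc (p - q) ^ 2 = (s * d - t * c) ^ 2 * (s * d + t * c) ^ 2 := by rw [hprod, mul_pow]
    _ ≤ (s * d - t * c) ^ 2 := mul_le_of_le_one_right (sq_nonneg _) hle
    _ = _ := by linarith

/-- The total variation distance between two product Gaussian measures on
`ℝ^m` with mean vectors `a, b` and common variance `σ²` is bounded by
`(1/(2σ)) * ‖a - b‖₂`. -/
theorem stmt_13 (σ : ℝ) (hσ : 0 < σ) (m : ℕ) (hm : 1 ≤ m) (a b : Fin m → ℝ)
    (A : Set (Fin m → ℝ)) (hA : MeasurableSet A) :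
    |((Measure.pi fun j => gaussianReal (a j) ⟨σ ^ 2, sq_nonneg σ⟩) A).toReal
        - ((Measure.pi fun j => gaussianReal (b j) ⟨σ ^ 2, sq_nonneg σ⟩) A).toReal|
      ≤ (1 / (2 * σ)) * Real.sqrt (∑ j, (a j - b j) ^ 2) := by
  set v : ℝ≥0 := ⟨σ ^ 2, sq_nonneg σ⟩
  have hvσ : (v : ℝ) = σ ^ 2 := rfl
  have hv : v ≠ 0 := by
    rw [← NNReal.coe_ne_zero, hvσ]
    positivity
  have hS : 0 ≤ ∑ j, (a j - b j) ^ 2 := Finset.sum_nonneg fun _ _ => sq_nonneg _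
  set S := ∑ j, (a j - b j) ^ 2 with hS_def
  have h₁ := exp_mul_pi_gaussianReal_le a b hv hA
  have h₂ := exp_mul_pi_gaussianReal_le a b hv hA.compl
  simp only [probReal_compl_eq_one_sub hA] at h₂
  rw [← hS_def, hvσ] at h₁ h₂
  change |(Measure.pi fun j => gaussianReal (a j) v).real A -
    (Measure.pi fun j => gaussianReal (b j) v).real A| ≤ _
  have h₃ := sq_sub_le_one_sub_sq_affinity
    (p := (Measure.pi fun j => gaussianReal (a j) v).real A)
    (q := (Measure.pi fun j => gaussianReal (b j) v).real A)
    measureReal_nonneg measureReal_le_one measureReal_nonneg measureReal_le_one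
  have h₄ := add_le_add h₁ h₂
  rw [← mul_add, add_sub_cancel, mul_one] at h₄
  replace h₄ := pow_le_pow_left₀ (Real.exp_pos _).le h₄ 2
  have h₅ : 1 - S / (4 * σ ^ 2) ≤ Real.exp (-(S / (8 * σ ^ 2))) ^ 2 := by
    rw [← Real.exp_nat_mul]
    refine le_trans (le_of_eq ?_) (Real.add_one_le_exp _)
    push_cast
    field_simp
    ring
  refine abs_le_of_sq_le_sq ?_ (by positivity)
  rw [mul_pow, Real.sq_sqrt hS]
  calc _ ≤ S / (4 * σ ^ 2) := by linarith
    _ = _ := by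
      field_simp
      ring
end

section
/- Let I ⊆ ℝ be a compact interval, γ ∈ (0,1], and κ, K, M > 0. Suppose f : I → ℝ is differentiable with f(x) ≥ κ and |f′(x)| ≤ M for all x ∈ I, and |f′(x) − f′(y)| ≤ K|x − y|^γ for all x, y ∈ I. Then the squared Hellinger-type discretization error satisfies ∫_I (√(f(x)) − √(f̂_m(x)))² ν₀(dx) ≤ (1/(4κ)) [ 2μ (Mℓ_m + 5Kℓ_m^{1+γ})² + 25 K² ν₀(I) ℓ_m^{2+2γ} ]; in particular H_m²(f) := ∫_I (√f − √(f̂_m))² dν₀ = O(μ ℓ_m² + ℓ_m^{2+2γ}) with the implied constant depending only on K, M, κ, γ and ν₀(I). -/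
open MeasureTheory

/-- First-order Taylor estimate for a function whose derivative is `γ`-Hölder. -/
lemma abs_taylor_le_of_holder {a b γ K : ℝ} (hγ0 : 0 < γ) (hK : 0 < K) {f f' : ℝ → ℝ}
    (hderiv : ∀ x ∈ Set.Icc a b, HasDerivWithinAt f (f' x) (Set.Icc a b) x)
    (hHolder : ∀ x ∈ Set.Icc a b, ∀ y ∈ Set.Icc a b, |f' x - f' y| ≤ K * |x - y| ^ γ)
    {c y d : ℝ} (hc : c ∈ Set.Icc a b) (hy : y ∈ Set.Icc a b) (hd : |y - c| ≤ d) :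
    |f y - f c - f' c * (y - c)| ≤ K * d ^ (1 + γ) := by
  have hd0 : 0 ≤ d := (abs_nonneg _).trans hd
  have hsub : Set.uIcc c y ⊆ Set.Icc a b := Set.ordConnected_Icc.uIcc_subset hc hy
  have key := (convex_uIcc c y).norm_image_sub_le_of_norm_hasDerivWithin_le
    (f := fun z => f z - f' c * z) (f' := fun z => f' z - f' c) (C := K * d ^ γ)
    (fun z hz => by
      simpa using ((hderiv z (hsub hz)).mono hsub).fun_sub
        ((hasDerivWithinAt_id z (Set.uIcc c y)).const_mul (f' c)))
    (fun z hz => by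
      refine (hHolder z (hsub hz) c hc).trans ?_
      have : |z - c| ≤ d := (Set.abs_sub_left_of_mem_uIcc hz).trans hd
      gcongr)
    Set.left_mem_uIcc Set.right_mem_uIcc
  simp only [Real.norm_eq_abs] at key
  calc |f y - f c - f' c * (y - c)| = |f y - f' c * y - (f c - f' c * c)| := by ring_nf
    _ ≤ K * d ^ γ * |y - c| := key
    _ ≤ K * d ^ γ * d := by gcongr
    _ = K * d ^ (1 + γ) := by
      rw [Real.rpow_add_of_nonneg hd0 zero_le_one hγ0.le, Real.rpow_one]; ring

lemma sq_sqrt_sub_sqrt_le {κ u v D : ℝ} (hκ : 0 < κ) (hu : κ ≤ u) (hv : κ ≤ v)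
    (h : |u - v| ≤ D) : (√u - √v) ^ 2 ≤ 1 / (4 * κ) * D ^ 2 := by
  have hu' := Real.sq_sqrt (hκ.le.trans hu)
  have hv' := Real.sq_sqrt (hκ.le.trans hv)
  have hκ' := Real.sq_sqrt hκ.le
  have h1 := Real.sqrt_le_sqrt hu
  have h2 := Real.sqrt_le_sqrt hv
  have h3 := Real.sqrt_nonneg κ
  have h4 : 4 * κ ≤ (√u + √v) ^ 2 := by nlinarith
  have h5 : (√u - √v) ^ 2 * (√u + √v) ^ 2 = (u - v) ^ 2 := by
    rw [← mul_pow]; congr 1; nlinarith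
  have h6 : (u - v) ^ 2 ≤ D ^ 2 := sq_le_sq.mpr (h.trans (le_abs_self D))
  rw [one_div, ← div_eq_inv_mul, le_div_iff₀ (by positivity)]
  nlinarith [sq_nonneg (√u - √v)]

/-- The barycenter of a measure on an order-connected set lies in the set. -/
lemma barycenter_mem_s15 {ν₀ : Measure ℝ} [IsFiniteMeasure ν₀] {S : Set ℝ} {μ : ℝ}
    (hS : S.OrdConnected) (hμ : ν₀.real S = μ) (hμpos : 0 < μ)
    (hint : IntegrableOn (fun x => x) S ν₀) : (∫ x in S, x ∂ν₀) / μ ∈ S := by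
  have h0 : ν₀ S ≠ 0 := fun h => by simp [Measure.real, h] at hμ; linarith
  have havg : (∫ x in S, x ∂ν₀) / μ = ⨍ x in S, x ∂ν₀ := by
    rw [setAverage_eq, hμ, smul_eq_mul]; ring
  obtain ⟨y, hy, hy'⟩ := exists_le_setAverage h0 (measure_ne_top _ _) hint
  obtain ⟨z, hz, hz'⟩ := exists_setAverage_le h0 (measure_ne_top _ _) hint
  rw [havg]
  exact hS.out hy hz ⟨hy', hz'⟩

lemma le_setIntegral_div {ν₀ : Measure ℝ} [IsFiniteMeasure ν₀] {S : Set ℝ} {μ κ : ℝ} {f : ℝ → ℝ}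
    (hμ : ν₀.real S = μ) (hμpos : 0 < μ) (hint : IntegrableOn f S ν₀)
    (hf : ∀ x ∈ S, κ ≤ f x) : κ ≤ (∫ x in S, f x ∂ν₀) / μ := by
  have h0 : ν₀ S ≠ 0 := fun h => by simp [Measure.real, h] at hμ; linarith
  have havg : (∫ x in S, f x ∂ν₀) / μ = ⨍ x in S, f x ∂ν₀ := by
    rw [setAverage_eq, hμ, smul_eq_mul]; ring
  obtain ⟨y, hy, hy'⟩ := exists_le_setAverage h0 (measure_ne_top _ _) hint
  rw [havg]
  exact (hf y hy).trans hy'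

/-- The average of a function approximated by an affine one is close to its value at the
barycenter. -/
lemma abs_setIntegral_div_sub_le {ν₀ : Measure ℝ} [IsFiniteMeasure ν₀] {S : Set ℝ}
    {μ c p q E : ℝ} {f : ℝ → ℝ} (hμ : ν₀.real S = μ) (hμpos : 0 < μ)
    (hint : IntegrableOn f S ν₀) (hid : IntegrableOn (fun x => x) S ν₀)
    (hc : c = (∫ x in S, x ∂ν₀) / μ)
    (hf : ∀ y ∈ S, |f y - p - q * (y - c)| ≤ E) :
    |(∫ x in S, f x ∂ν₀) / μ - p| ≤ E := by
  have hcst (r : ℝ) : IntegrableOn (fun _ : ℝ => r) S ν₀ := integrableOn_const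
  have h1 : ∫ y in S, (f y - p - q * (y - c)) ∂ν₀ = ((∫ x in S, f x ∂ν₀) / μ - p) * μ := by
    have hfp : IntegrableOn (fun y => f y - p) S ν₀ := hint.sub (hcst p)
    have hyc : IntegrableOn (fun y => y - c) S ν₀ := hid.sub (hcst c)
    rw [integral_sub hfp (hyc.const_mul q), integral_sub hint (hcst p), integral_const_mul,
      integral_sub hid (hcst c),
      setIntegral_const, setIntegral_const, hμ, hc, smul_eq_mul, smul_eq_mul]
    field_simp
    ring
  have h2 := norm_setIntegral_le_of_norm_le_const
    (f := fun y => f y - p - q * (y - c)) (measure_lt_top ν₀ S) hf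
  rw [h1, hμ, Real.norm_eq_abs, abs_mul, abs_of_pos hμpos] at h2
  exact le_of_mul_le_mul_right h2 hμpos

/-- Error of the linear interpolation at `x` of approximate nodal values. -/
lemma abs_sub_interpolation_le_s15 {u v x fu fv fx p A B E F κ : ℝ} (hux : u ≤ x) (hxv : x ≤ v)
    (huv : u < v) (hA : |A - fu| ≤ E) (hB : |B - fv| ≤ E)
    (hu : |fu - fx - p * (u - x)| ≤ F) (hv : |fv - fx - p * (v - x)| ≤ F)
    (hAκ : κ ≤ A) (hBκ : κ ≤ B) :
    |fx - (B * (x - u) + A * (v - x)) / (v - u)| ≤ F + E ∧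
      κ ≤ (B * (x - u) + A * (v - x)) / (v - u) := by
  have hh : 0 < v - u := sub_pos.mpr huv
  have h1 : 0 ≤ x - u := sub_nonneg.mpr hux
  have h2 : 0 ≤ v - x := sub_nonneg.mpr hxv
  rw [abs_le] at hA hB hu hv
  constructor
  · rw [abs_le, neg_le_sub_iff_le_add, sub_le_comm, ← sub_le_iff_le_add,
      le_div_iff₀ hh, sub_le_iff_le_add, div_le_iff₀ hh]
    constructor <;>
    nlinarith [mul_nonneg h1 (sub_nonneg.mpr hB.1), mul_nonneg h1 (sub_nonneg.mpr hB.2),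
      mul_nonneg h2 (sub_nonneg.mpr hA.1), mul_nonneg h2 (sub_nonneg.mpr hA.2),
      mul_nonneg h1 (sub_nonneg.mpr hv.1), mul_nonneg h1 (sub_nonneg.mpr hv.2),
      mul_nonneg h2 (sub_nonneg.mpr hu.1), mul_nonneg h2 (sub_nonneg.mpr hu.2)]
  · rw [le_div_iff₀ hh]
    nlinarith [mul_nonneg h1 (sub_nonneg.mpr hBκ), mul_nonneg h2 (sub_nonneg.mpr hAκ)]

lemma exists_mem_Ioc_of_le {u : ℕ → ℝ} {x : ℝ} (h0 : u 0 < x) {n : ℕ} (hn : x ≤ u n) :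
    ∃ j < n, x ∈ Set.Ioc (u j) (u (j + 1)) := by
  induction n with
  | zero => linarith
  | succ n ih =>
    by_cases h : x ≤ u n
    · obtain ⟨j, hj, hx⟩ := ih h
      exact ⟨j, by omega, hx⟩
    · exact ⟨n, by omega, not_le.mp h, hn⟩

/-- In the equal-mass-partition setting, if `f ≥ κ > 0`, `|f′| ≤ M` and
`f′` is `γ`-Hölder with constant `K` on `I = [a,b]`, then the squared Hellinger-type
discretization error satisfies
`∫_I (√f − √(f̂_m))² dν₀ ≤ (1/(4κ)) [2μ (Mℓ_m + 5Kℓ_m^{1+γ})² + 25 K² ν₀(I) ℓ_m^{2+2γ}]`. -/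
theorem stmt_15
    (a b : ℝ) (hab : a ≤ b)
    (ν₀ : Measure ℝ) [IsFiniteMeasure ν₀]
    (γ : ℝ) (hγ0 : 0 < γ) (hγ1 : γ ≤ 1)
    (κ K M : ℝ) (hκ : 0 < κ) (hK : 0 < K) (hM : 0 < M)
    (m : ℕ) (hm : 2 ≤ m)
    (J : Fin m → Set ℝ)
    (hJint : ∀ j, (J j).OrdConnected)
    (hJdisj : ∀ i j : Fin m, i ≠ j → Disjoint (J i) (J j))
    (hJunion : (⋃ j, J j) = Set.Icc a b)
    (hJorder : ∀ i j : Fin m, i < j → ∀ x ∈ J i, ∀ y ∈ J j, x ≤ y)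
    (hJmass : ∀ j, ν₀ (J j) = ν₀ (Set.Icc a b) / m)
    (μ : ℝ) (hμ : μ = (ν₀ (Set.Icc a b)).toReal / m) (hμpos : 0 < μ)
    (xstar : Fin m → ℝ) (hxstar : ∀ j, xstar j = (∫ x in J j, x ∂ν₀) / μ)
    (ℓ : ℝ)
    (hℓ : ℓ = Finset.univ.sup' (Finset.univ_nonempty_iff.mpr ⟨⟨0, by omega⟩⟩)
      fun j => Metric.diam (J j))
    (f f' : ℝ → ℝ)
    (hderiv : ∀ x ∈ Set.Icc a b, HasDerivWithinAt f (f' x) (Set.Icc a b) x)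
    (hfκ : ∀ x ∈ Set.Icc a b, κ ≤ f x)
    (hf'M : ∀ x ∈ Set.Icc a b, |f' x| ≤ M)
    (hHolder : ∀ x ∈ Set.Icc a b, ∀ y ∈ Set.Icc a b, |f' x - f' y| ≤ K * |x - y| ^ γ)
    (νJ : Fin m → ℝ) (hνJ : ∀ j, νJ j = ∫ x in J j, f x ∂ν₀)
    (fhat : ℝ → ℝ)
    (hfhat1 : ∀ x ∈ Set.Icc a b, x ≤ xstar ⟨0, by omega⟩ →
      fhat x = νJ ⟨0, by omega⟩ / μ)
    (hfhat2 : ∀ (j : ℕ) (hj : j + 1 < m),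
      ∀ x ∈ Set.Ioc (xstar ⟨j, by omega⟩) (xstar ⟨j + 1, hj⟩),
      fhat x = (νJ ⟨j + 1, hj⟩ * (x - xstar ⟨j, by omega⟩)
          + νJ ⟨j, by omega⟩ * (xstar ⟨j + 1, hj⟩ - x))
        / (μ * (xstar ⟨j + 1, hj⟩ - xstar ⟨j, by omega⟩)))
    (hfhat3 : ∀ x ∈ Set.Icc a b, xstar ⟨m - 1, by omega⟩ < x →
      fhat x = νJ ⟨m - 1, by omega⟩ / μ) :
    ∫ x in Set.Icc a b, (Real.sqrt (f x) - Real.sqrt (fhat x)) ^ 2 ∂ν₀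
      ≤ (1 / (4 * κ)) * (2 * μ * (M * ℓ + 5 * K * ℓ ^ (1 + γ)) ^ 2
        + 25 * K ^ 2 * (ν₀ (Set.Icc a b)).toReal * ℓ ^ (2 + 2 * γ)) := by
  have hm0 : 0 < m := by omega
  have hJsub (j) : J j ⊆ Set.Icc a b := hJunion ▸ Set.subset_iUnion J j
  have hJmeas (j) : MeasurableSet (J j) := (hJint j).measurableSet
  have hJμ (j) : ν₀.real (J j) = μ := by
    rw [Measure.real, hJmass, hμ, ENNReal.toReal_div, ENNReal.toReal_natCast]
  have hfcont : ContinuousOn f (Set.Icc a b) := fun x hx => (hderiv x hx).continuousWithinAt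
  have hfint (j) : IntegrableOn f (J j) ν₀ :=
    (hfcont.integrableOn_compact isCompact_Icc).mono_set (hJsub j)
  have hid (j) : IntegrableOn (fun x : ℝ => x) (J j) ν₀ :=
    (continuousOn_id.integrableOn_compact isCompact_Icc).mono_set (hJsub j)
  have hxs (j) : xstar j ∈ J j := by
    rw [hxstar]; exact barycenter_mem_s15 (hJint j) (hJμ j) hμpos (hid j)
  have hxsI (j) : xstar j ∈ Set.Icc a b := hJsub j (hxs j)
  have hmono {i j : Fin m} (hij : i < j) : xstar i < xstar j :=
    lt_of_le_of_ne (hJorder i j hij _ (hxs i) _ (hxs j)) fun h =>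
      Set.disjoint_left.mp (hJdisj i j hij.ne) (hxs i) (h ▸ hxs j)
  have hdist (j) {x y : ℝ} (hx : x ∈ J j) (hy : y ∈ J j) : |x - y| ≤ ℓ := by
    refine (Metric.dist_le_diam_of_mem ((Metric.isBounded_Icc a b).subset (hJsub j)) hx hy).trans ?_
    rw [hℓ]
    exact Finset.le_sup' (fun j => Metric.diam (J j)) (Finset.mem_univ j)
  have hℓ0 : 0 ≤ ℓ := (abs_nonneg _).trans (hdist ⟨0, hm0⟩ (hxs _) (hxs _))
  have hmem {x : ℝ} (hx : x ∈ Set.Icc a b) : ∃ j, x ∈ J j := by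
    rwa [← hJunion, Set.mem_iUnion] at hx
  have hE0 : 0 ≤ K * ℓ ^ (1 + γ) := by positivity
  have htaylor := fun {c y d : ℝ} => abs_taylor_le_of_holder (c := c) (y := y) (d := d)
    hγ0 hK hderiv hHolder
  have hκJ (j) : κ ≤ νJ j / μ := by
    rw [hνJ]
    exact le_setIntegral_div (hJμ j) hμpos (hfint j) fun x hx => hfκ x (hJsub j hx)
  have hJavg (j) : |νJ j / μ - f (xstar j)| ≤ K * ℓ ^ (1 + γ) := by
    rw [hνJ]
    exact abs_setIntegral_div_sub_le (q := f' (xstar j)) (hJμ j) hμpos (hfint j) (hid j)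
      (hxstar j) fun y hy => htaylor (hxsI j) (hJsub j hy) (hdist j hy (hxs j))
  have hboundary (j) {x : ℝ} (hx : x ∈ J j) :
      |f x - νJ j / μ| ≤ M * ℓ + 5 * K * ℓ ^ (1 + γ) := by
    have h1 : |f x - f (xstar j)| ≤ M * |x - xstar j| :=
      (convex_Icc a b).norm_image_sub_le_of_norm_hasDerivWithin_le hderiv hf'M (hxsI j)
        (hJsub j hx)
    have h2 : M * |x - xstar j| ≤ M * ℓ :=
      mul_le_mul_of_nonneg_left (hdist j hx (hxs j)) hM.le
    have h3 := abs_sub_le (f x) (f (xstar j)) (νJ j / μ)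
    rw [abs_sub_comm (f (xstar j))] at h3
    linarith [hJavg j]
  have hgap {i j : Fin m} (hij : (i : ℕ) + 1 = j) : xstar j - xstar i ≤ 2 * ℓ := by
    have hlt : xstar i < xstar j := hmono (by rw [Fin.lt_def]; omega)
    obtain ⟨k, hk⟩ := hmem (x := (xstar i + xstar j) / 2)
      ⟨by linarith [(hxsI i).1], by linarith [(hxsI j).2]⟩
    have hik : i ≤ k := not_lt.mp fun h => by linarith [hJorder k i h _ hk _ (hxs i)]
    have hkj : k ≤ j := not_lt.mp fun h => by linarith [hJorder j k h _ (hxs j) _ hk]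
    have : k = i ∨ k = j := by rw [Fin.le_def] at hik hkj; rw [Fin.ext_iff, Fin.ext_iff]; omega
    rcases this with rfl | rfl
    · linarith [le_abs_self ((xstar k + xstar j) / 2 - xstar k), hdist k hk (hxs k)]
    · linarith [neg_abs_le ((xstar i + xstar k) / 2 - xstar k), hdist k hk (hxs k)]
  have hpow : (2 * ℓ) ^ (1 + γ) ≤ 4 * ℓ ^ (1 + γ) := by
    rw [Real.mul_rpow zero_le_two hℓ0]
    have : (2 : ℝ) ^ (1 + γ) ≤ 2 ^ (2 : ℝ) :=
      Real.rpow_le_rpow_of_exponent_le one_le_two (by linarith)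
    norm_num at this
    gcongr
  have hinterior {i j : Fin m} (hij : (i : ℕ) + 1 = j) {x : ℝ}
      (hx : x ∈ Set.Ioc (xstar i) (xstar j)) :
      |f x - (νJ j * (x - xstar i) + νJ i * (xstar j - x)) / (μ * (xstar j - xstar i))|
          ≤ 5 * K * ℓ ^ (1 + γ) ∧
        κ ≤ (νJ j * (x - xstar i) + νJ i * (xstar j - x)) / (μ * (xstar j - xstar i)) := by
    have hxI : x ∈ Set.Icc a b := ⟨(hxsI i).1.trans hx.1.le, hx.2.trans (hxsI j).2⟩
    have hg := hgap hij
    have hrw : (νJ j * (x - xstar i) + νJ i * (xstar j - x)) / (μ * (xstar j - xstar i))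
        = (νJ j / μ * (x - xstar i) + νJ i / μ * (xstar j - x)) / (xstar j - xstar i) := by
      rw [← div_div]; congr 1; ring
    have hu := htaylor (d := 2 * ℓ) hxI (hxsI i)
      (abs_le.mpr ⟨by linarith [hx.2], by linarith [hx.1]⟩)
    have hv := htaylor (d := 2 * ℓ) hxI (hxsI j)
      (abs_le.mpr ⟨by linarith [hx.2], by linarith [hx.1]⟩)
    rw [hrw]
    obtain ⟨h1, h2⟩ := abs_sub_interpolation_le_s15 hx.1.le hx.2 (hx.1.trans_le hx.2) (hJavg i)
      (hJavg j) hu hv (hκJ i) (hκJ j)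
    refine ⟨h1.trans ?_, h2⟩
    linarith [mul_le_mul_of_nonneg_left hpow hK.le]
  set A := M * ℓ + 5 * K * ℓ ^ (1 + γ)
  set B := 5 * K * ℓ ^ (1 + γ) with hB
  let i₀ : Fin m := ⟨0, hm0⟩
  let i₁ : Fin m := ⟨m - 1, by omega⟩
  have hpointwise (x : ℝ) (hx : x ∈ Set.Icc a b) : (√(f x) - √(fhat x)) ^ 2 ≤
      1 / (4 * κ) * ((J i₀).indicator (fun _ => A ^ 2) x + (J i₁).indicator (fun _ => A ^ 2) x
        + B ^ 2) := by
    have hind (j) : 0 ≤ (J j).indicator (fun _ => A ^ 2) x :=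
      Set.indicator_nonneg (fun _ _ => sq_nonneg A) x
    have hfx := hfκ x hx
    obtain ⟨k, hk⟩ := hmem hx
    by_cases hx0 : x ≤ xstar i₀
    · have hxJ : x ∈ J i₀ := by
        rcases eq_or_lt_of_le (show i₀ ≤ k from Nat.zero_le _) with h | h
        · exact h ▸ hk
        · exact (hJorder _ _ h _ (hxs i₀) _ hk).antisymm hx0 ▸ hxs i₀
      refine (sq_sqrt_sub_sqrt_le hκ hfx (v := fhat x) (D := A) ?_ ?_).trans ?_
      · rw [hfhat1 x hx hx0]; exact hκJ _
      · rw [hfhat1 x hx hx0]; exact hboundary _ hxJ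
      · gcongr
        rw [Set.indicator_of_mem hxJ]
        linarith [hind i₁, sq_nonneg B]
    by_cases hx1 : xstar i₁ < x
    · have hxJ : x ∈ J i₁ := by
        rcases eq_or_lt_of_le (show k ≤ i₁ from Nat.le_sub_one_of_lt k.2) with h | h
        · exact h ▸ hk
        · exact absurd (hJorder _ _ h _ hk _ (hxs i₁)) (not_le.mpr hx1)
      refine (sq_sqrt_sub_sqrt_le hκ hfx (v := fhat x) (D := A) ?_ ?_).trans ?_
      · rw [hfhat3 x hx hx1]; exact hκJ _
      · rw [hfhat3 x hx hx1]; exact hboundary _ hxJ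
      · gcongr
        rw [Set.indicator_of_mem hxJ]
        linarith [hind i₀, sq_nonneg B]
    obtain ⟨j, hj, hxj⟩ := exists_mem_Ioc_of_le
      (u := fun n => if h : n < m then xstar ⟨n, h⟩ else 0) (x := x) (n := m - 1)
      (by simpa [hm0] using hx0) (by simpa [hm0] using hx1)
    have hj1 : j + 1 < m := by omega
    simp only [hj1, show j < m by omega, dif_pos] at hxj
    obtain ⟨h1, h2⟩ := hinterior (i := ⟨j, by omega⟩) (j := ⟨j + 1, hj1⟩) rfl hxj
    rw [← hfhat2 j hj1 x hxj] at h1 h2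
    refine (sq_sqrt_sub_sqrt_le hκ hfx h2 h1).trans ?_
    gcongr
    linarith [hind i₀, hind i₁]
  have hint (j) : IntegrableOn ((J j).indicator fun _ => A ^ 2) (Set.Icc a b) ν₀ :=
    (integrable_const _).indicator (hJmeas j)
  have hcst : IntegrableOn (fun _ : ℝ => B ^ 2) (Set.Icc a b) ν₀ := integrableOn_const
  have hval (j) : ∫ x in Set.Icc a b, (J j).indicator (fun _ => A ^ 2) x ∂ν₀ = μ * A ^ 2 := by
    rw [setIntegral_indicator (hJmeas j), Set.inter_eq_self_of_subset_right (hJsub j),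
      setIntegral_const, hJμ, smul_eq_mul]
  have hadd : IntegrableOn (fun x => (J i₀).indicator (fun _ => A ^ 2) x
      + (J i₁).indicator (fun _ => A ^ 2) x) (Set.Icc a b) ν₀ := (hint i₀).add (hint i₁)
  refine (integral_mono_of_nonneg (.of_forall fun x => sq_nonneg _)
    ((hadd.add hcst).const_mul (1 / (4 * κ)))
    ((ae_restrict_iff' measurableSet_Icc).mpr (.of_forall hpointwise))).trans_eq ?_
  simp only [Pi.add_apply]
  rw [integral_const_mul, integral_add hadd hcst,
    integral_add (hint i₀) (hint i₁), hval, hval, setIntegral_const, smul_eq_mul]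
  have hBsq : B ^ 2 = 25 * K ^ 2 * ℓ ^ (2 + 2 * γ) := by
    have : (ℓ ^ (1 + γ)) ^ 2 = ℓ ^ (2 + 2 * γ) := by
      rw [← Real.rpow_mul_natCast hℓ0]; congr 1; push_cast; ring
    rw [hB, mul_pow, this]; ring
  rw [hBsq, Measure.real]
  ring
end

section
/- Let I ⊆ ℝ be a compact interval of diameter D, γ ∈ (0,1], and κ, K, M > 0. Suppose f : I → ℝ is differentiable with κ ≤ f(x) ≤ M and |f′(x)| ≤ M for all x ∈ I, and |f′(x) − f′(y)| ≤ K|x − y|^γ for all x, y ∈ I. Let (√f)^_m denote the piecewise-linear approximation construction applied to the function √f (i.e., built from the cell averages ∫_{J_j} √f dν₀ / μ). Then there is a constant C depending only on γ, K, M, κ, D and ν₀(I) such that A_m²(f) := ∫_I ( (√f)^_m(y) − √(f(y)) )² ν₀(dy) ≤ C ( μ ℓ_m² + ℓ_m^{2+2γ} ). -/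
open MeasureTheory

/-- First-order Taylor estimate on an interval for a function with Hölder derivative. -/
lemma abs_sub_sub_mul_le_of_holder_deriv {a b H γ : ℝ} (hH : 0 ≤ H) (hγ : 0 ≤ γ) {h h' : ℝ → ℝ}
    (hd : ∀ x ∈ Set.Icc a b, HasDerivWithinAt h (h' x) (Set.Icc a b) x)
    (hh : ∀ x ∈ Set.Icc a b, ∀ y ∈ Set.Icc a b, |h' x - h' y| ≤ H * |x - y| ^ γ)
    {x y d : ℝ} (hx : x ∈ Set.Icc a b) (hy : y ∈ Set.Icc a b) (hxy : |y - x| ≤ d) :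
    |h y - h x - h' x * (y - x)| ≤ H * d ^ (1 + γ) := by
  have hd0 : 0 ≤ d := (abs_nonneg _).trans hxy
  have hsub : Set.uIcc x y ⊆ Set.Icc a b := Set.OrdConnected.uIcc_subset Set.ordConnected_Icc hx hy
  have key := (convex_uIcc x y).norm_image_sub_le_of_norm_hasDerivWithin_le
    (f := fun t => h t - h' x * t) (f' := fun t => h' t - h' x * 1) (C := H * d ^ γ)
    (fun t ht => ((hd t (hsub ht)).mono hsub).sub ((hasDerivWithinAt_id t _).const_mul (h' x)))
    (fun t ht => by
      rw [mul_one, Real.norm_eq_abs]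
      refine (hh t (hsub ht) x hx).trans ?_
      gcongr
      exact (Set.abs_sub_left_of_mem_uIcc ht).trans hxy)
    (Set.left_mem_uIcc) (Set.right_mem_uIcc)
  simp only [Real.norm_eq_abs] at key
  calc |h y - h x - h' x * (y - x)| = |h y - h' x * y - (h x - h' x * x)| := by ring_nf
    _ ≤ H * d ^ γ * |y - x| := key
    _ ≤ H * d ^ γ * d := by gcongr
    _ = H * d ^ (1 + γ) := by
      rw [Real.rpow_add_of_nonneg hd0 zero_le_one hγ, Real.rpow_one]; ring

section Average

variable {ν : Measure ℝ} [IsFiniteMeasure ν] {s : Set ℝ}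

/-- An average is at most any upper bound of the integrand. -/
lemma setIntegral_div_le (hs : MeasurableSet s) (hpos : 0 < ν.real s) {g : ℝ → ℝ}
    (hg : IntegrableOn g s ν) {c : ℝ} (hc : ∀ x ∈ s, g x ≤ c) :
    (∫ x in s, g x ∂ν) / ν.real s ≤ c := by
  rw [div_le_iff₀ hpos]
  have := setIntegral_mono_on hg (integrableOn_const (C := c) (measure_ne_top ν s)) hs hc
  rwa [setIntegral_const, smul_eq_mul, mul_comm] at this

/-- An average is at least any lower bound of the integrand. -/
lemma le_setIntegral_div_s16 (hs : MeasurableSet s) (hpos : 0 < ν.real s) {g : ℝ → ℝ}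
    (hg : IntegrableOn g s ν) {c : ℝ} (hc : ∀ x ∈ s, c ≤ g x) :
    c ≤ (∫ x in s, g x ∂ν) / ν.real s := by
  rw [le_div_iff₀ hpos]
  have := setIntegral_mono_on (integrableOn_const (C := c) (measure_ne_top ν s)) hg hs hc
  rwa [setIntegral_const, smul_eq_mul, mul_comm] at this

/-- The average of a function is close to the value at a point around which it is
almost affine, provided that the point is the barycenter. -/
lemma abs_setIntegral_div_sub_le_s16 (hs : MeasurableSet s) (hpos : 0 < ν.real s) {g : ℝ → ℝ}
    (hg : IntegrableOn g s ν) (hid : IntegrableOn (fun x => x) s ν) {p q c B : ℝ}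
    (hc : c = (∫ x in s, x ∂ν) / ν.real s) (hB : ∀ x ∈ s, |g x - p - q * (x - c)| ≤ B) :
    |(∫ x in s, g x ∂ν) / ν.real s - p| ≤ B := by
  have hconst : ∀ r : ℝ, IntegrableOn (fun _ => r) s ν := fun r =>
    integrableOn_const (measure_ne_top ν s)
  have hlin : IntegrableOn (fun x => q * (x - c)) s ν := (hid.sub (hconst c)).const_mul q
  have hsub : IntegrableOn (fun x => g x - p) s ν := hg.sub (hconst p)
  have h_int : IntegrableOn (fun x => g x - p - q * (x - c)) s ν := hsub.sub hlin
  have heq : (∫ x in s, g x ∂ν) / ν.real s - p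
      = (∫ x in s, (g x - p - q * (x - c)) ∂ν) / ν.real s := by
    rw [integral_sub hsub hlin, integral_sub hg (hconst p), integral_const_mul,
      integral_sub hid (hconst c), setIntegral_const, setIntegral_const, hc]
    simp only [smul_eq_mul]
    field_simp
    ring
  rw [heq, abs_le]
  exact ⟨le_setIntegral_div_s16 hs hpos h_int fun x hx => (abs_le.1 (hB x hx)).1,
    setIntegral_div_le hs hpos h_int fun x hx => (abs_le.1 (hB x hx)).2⟩

end Average

/-- A real number between the first and some other term of a finite sequence lies between two
consecutive terms. -/
lemma exists_consecutive_mem_Ioc {m : ℕ} {u : Fin m → ℝ} {x : ℝ} (i l : Fin m)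
    (hi : (i : ℕ) = 0) (h₀ : u i < x) (h₁ : x ≤ u l) :
    ∃ j k : Fin m, (j : ℕ) + 1 = k ∧ x ∈ Set.Ioc (u j) (u k) := by
  by_contra! hcon
  have hlt : ∀ n (hn : n < m), u ⟨n, hn⟩ < x := by
    intro n
    induction n with
    | zero =>
      intro hn
      have : i = ⟨0, hn⟩ := Fin.ext hi
      rwa [← this]
    | succ n ih =>
      intro hn
      by_contra! hle
      exact hcon ⟨n, by omega⟩ ⟨n + 1, hn⟩ rfl ⟨ih (by omega), hle⟩
  exact absurd h₁ (not_le.2 (hlt l l.2))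

/-- Points of neighbouring cells of an ordered interval partition are at distance at most twice
the mesh. -/
lemma sub_le_two_mul_of_consecutive {a b ℓ : ℝ} {m : ℕ} {J : Fin m → Set ℝ}
    (hU : (⋃ j, J j) = Set.Icc a b)
    (hord : ∀ i j : Fin m, i < j → ∀ x ∈ J i, ∀ y ∈ J j, x ≤ y)
    (hdist : ∀ j, ∀ x ∈ J j, ∀ y ∈ J j, |x - y| ≤ ℓ) {j k : Fin m} (hjk : (j : ℕ) + 1 = k)
    {x y : ℝ} (hx : x ∈ J j) (hy : y ∈ J k) : y - x ≤ 2 * ℓ := by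
  have hxI : x ∈ Set.Icc a b := hU ▸ Set.mem_iUnion_of_mem j hx
  have hyI : y ∈ Set.Icc a b := hU ▸ Set.mem_iUnion_of_mem k hy
  have hxy : x ≤ y := hord j k (Fin.lt_def.2 (by omega)) x hx y hy
  have hℓ : 0 ≤ ℓ := (abs_nonneg _).trans (hdist j x hx x hx)
  have hc : (x + y) / 2 ∈ ⋃ j, J j := by
    rw [hU]; exact ⟨by linarith [hxI.1, hyI.1], by linarith [hxI.2, hyI.2]⟩
  obtain ⟨i, hi⟩ := Set.mem_iUnion.1 hc
  rcases lt_trichotomy i j with h | rfl | h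
  · linarith [hord i j h _ hi x hx]
  · linarith [(abs_le.1 (hdist i _ hi x hx)).2]
  · rcases lt_trichotomy i k with h' | rfl | h'
    · rw [Fin.lt_def] at h h'; omega
    · linarith [(abs_le.1 (hdist i y hy _ hi)).2]
    · linarith [hord k i h' y hy _ hi]

/-- Two-point linear interpolation of approximate values of an almost affine function. -/
lemma abs_interpolation_sub_le {p q x P Q hp hq v s B E : ℝ} (hx : x ∈ Set.Ioc p q)
    (hP : |P - hp| ≤ B) (hQ : |Q - hq| ≤ B)
    (hEp : |hp - v - s * (p - x)| ≤ E) (hEq : |hq - v - s * (q - x)| ≤ E) :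
    |(Q * (x - p) + P * (q - x)) / (q - p) - v| ≤ B + E := by
  obtain ⟨h1, h2⟩ := hx
  have hpq : 0 < q - p := by linarith
  have heq : (Q * (x - p) + P * (q - x)) / (q - p) - v
      = (((Q - hq) + (hq - v - s * (q - x))) * (x - p)
        + ((P - hp) + (hp - v - s * (p - x))) * (q - x)) / (q - p) := by
    field_simp
    ring
  rw [abs_le] at *
  rw [heq, le_div_iff₀ hpq, div_le_iff₀ hpq]
  have hxp : 0 ≤ x - p := by linarith
  have hqx : 0 ≤ q - x := by linarith
  have e1 : -(B + E) ≤ (Q - hq) + (hq - v - s * (q - x)) := by linarith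
  have e2 : (Q - hq) + (hq - v - s * (q - x)) ≤ B + E := by linarith
  have e3 : -(B + E) ≤ (P - hp) + (hp - v - s * (p - x)) := by linarith
  have e4 : (P - hp) + (hp - v - s * (p - x)) ≤ B + E := by linarith
  have g1 := mul_le_mul_of_nonneg_right e1 hxp
  have g2 := mul_le_mul_of_nonneg_right e2 hxp
  have g3 := mul_le_mul_of_nonneg_right e3 hqx
  have g4 := mul_le_mul_of_nonneg_right e4 hqx
  constructor <;> linarith

/-- The derivative of `√f` is bounded, and Hölder, on an interval on which `f` is bounded below
and has a bounded Hölder derivative. -/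
lemma sqrt_deriv_bounds {a b κ K M γ : ℝ} (hκ : 0 < κ) (hK : 0 < K) (hM : 0 < M)
    (hγ0 : 0 < γ) (hγ1 : γ ≤ 1) {f f' : ℝ → ℝ} (hf : ∀ x ∈ Set.Icc a b, κ ≤ f x)
    (hd : ∀ x ∈ Set.Icc a b, HasDerivWithinAt f (f' x) (Set.Icc a b) x)
    (hb : ∀ x ∈ Set.Icc a b, |f' x| ≤ M)
    (hh : ∀ x ∈ Set.Icc a b, ∀ y ∈ Set.Icc a b, |f' x - f' y| ≤ K * |x - y| ^ γ) :
    (∀ x ∈ Set.Icc a b, HasDerivWithinAt (fun x => √(f x)) (f' x / (2 * √(f x))) (Set.Icc a b) x) ∧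
    (∀ x ∈ Set.Icc a b, ∀ y ∈ Set.Icc a b, |√(f x) - √(f y)| ≤ M / (2 * √κ) * |x - y|) ∧
    (∀ x ∈ Set.Icc a b, ∀ y ∈ Set.Icc a b,
      |f' x / (2 * √(f x)) - f' y / (2 * √(f y))| ≤
        (K / (2 * √κ) + M * (M / (2 * √κ) * |b - a| ^ (1 - γ)) / (2 * κ)) * |x - y| ^ γ) := by
  have hs : 0 < √κ := Real.sqrt_pos.2 hκ
  have hsf : ∀ x ∈ Set.Icc a b, √κ ≤ √(f x) := fun x hx => Real.sqrt_le_sqrt (hf x hx)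
  have hder : ∀ x ∈ Set.Icc a b,
      HasDerivWithinAt (fun x => √(f x)) (f' x / (2 * √(f x))) (Set.Icc a b) x :=
    fun x hx => (hd x hx).sqrt (hκ.trans_le (hf x hx)).ne'
  have hlip : ∀ x ∈ Set.Icc a b, ∀ y ∈ Set.Icc a b,
      |√(f x) - √(f y)| ≤ M / (2 * √κ) * |x - y| := by
    intro x hx y hy
    refine (convex_Icc a b).norm_image_sub_le_of_norm_hasDerivWithin_le hder (fun t ht => ?_) hy hx
    have h2 := hsf t ht
    rw [Real.norm_eq_abs, abs_div, abs_of_pos (by linarith : 0 < 2 * √(f t))]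
    have := hb t ht
    gcongr
  refine ⟨hder, hlip, fun x hx y hy => ?_⟩
  have hx' := hsf x hx
  have hy' := hsf y hy
  have hxp : 0 < √(f x) := hs.trans_le hx'
  have hyp : 0 < √(f y) := hs.trans_le hy'
  have heq : f' x / (2 * √(f x)) - f' y / (2 * √(f y))
      = (f' x - f' y) / (2 * √(f x)) + f' y * (√(f y) - √(f x)) / (2 * (√(f x) * √(f y))) := by
    field_simp
    ring
  have hκle : κ ≤ √(f x) * √(f y) := by
    calc κ = √κ * √κ := (Real.mul_self_sqrt hκ.le).symm
      _ ≤ _ := by gcongr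
  have hpow : |x - y| ≤ |b - a| ^ (1 - γ) * |x - y| ^ γ := by
    have hle : |x - y| ≤ |b - a| := by
      rw [abs_of_nonneg (by linarith [hx.1, hx.2] : 0 ≤ b - a), abs_le]
      constructor <;> linarith [hx.1, hx.2, hy.1, hy.2]
    calc |x - y| = |x - y| ^ ((1 - γ) + γ) := by simp
      _ = |x - y| ^ (1 - γ) * |x - y| ^ γ :=
        Real.rpow_add_of_nonneg (abs_nonneg _) (by linarith) hγ0.le
      _ ≤ _ := by gcongr
  rw [heq]
  refine (abs_add_le _ _).trans ?_
  rw [abs_div, abs_div, abs_of_pos (by positivity : 0 < 2 * √(f x)),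
    abs_of_pos (by positivity : 0 < 2 * (√(f x) * √(f y))), abs_mul, abs_sub_comm (√(f y))]
  calc |f' x - f' y| / (2 * √(f x)) + |f' y| * |√(f x) - √(f y)| / (2 * (√(f x) * √(f y)))
      ≤ K * |x - y| ^ γ / (2 * √κ)
        + M * (M / (2 * √κ) * (|b - a| ^ (1 - γ) * |x - y| ^ γ)) / (2 * κ) := by
        gcongr
        · exact hh x hx y hy
        · exact hb y hy
        · refine (hlip x hx y hy).trans ?_
          gcongr
    _ = _ := by ring

/-- For every `γ ∈ (0,1]`, `K, M, κ > 0`, diameter `D` and total mass `V`,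
there is a constant `C > 0` (depending only on `γ, K, M, κ, D, V`) such that for every compact
interval `I = [a,b]` with `b - a = D` and finite Borel measure `ν₀` with `ν₀(I) = V`, every
equal-mass partition `J₁, …, J_m` (`m ≥ 2`, mass `μ`, barycenters `x_j*`,
`ℓ_m = max_j diam (J_j)`), and every `f` with `κ ≤ f ≤ M`, `|f′| ≤ M` and `γ`-Hölder `f′`
(constant `K`), the piecewise-linear approximation `(√f)^_m` of `√f` (built from the cell
averages `∫_{J_j} √f dν₀ / μ`) satisfies
`A_m²(f) = ∫_I ((√f)^_m − √f)² dν₀ ≤ C (μ ℓ_m² + ℓ_m^{2+2γ})`. -/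
theorem stmt_16
    (γ K M κ : ℝ) (hγ0 : 0 < γ) (hγ1 : γ ≤ 1) (hK : 0 < K) (hM : 0 < M) (hκ : 0 < κ)
    (D V : ℝ) :
    ∃ C : ℝ, 0 < C ∧
      ∀ (a b : ℝ), a ≤ b → b - a = D →
      ∀ (ν₀ : Measure ℝ), IsFiniteMeasure ν₀ → (ν₀ (Set.Icc a b)).toReal = V →
      ∀ (m : ℕ), 2 ≤ m →
      ∀ (J : Fin m → Set ℝ),
        (∀ j, (J j).OrdConnected) →
        (∀ i j : Fin m, i ≠ j → Disjoint (J i) (J j)) →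
        ((⋃ j, J j) = Set.Icc a b) →
        (∀ i j : Fin m, i < j → ∀ x ∈ J i, ∀ y ∈ J j, x ≤ y) →
        (∀ j, ν₀ (J j) = ν₀ (Set.Icc a b) / m) →
      ∀ (μ : ℝ), μ = (ν₀ (Set.Icc a b)).toReal / m → 0 < μ →
      ∀ (xstar : Fin m → ℝ), (∀ j, xstar j = (∫ x in J j, x ∂ν₀) / μ) →
      ∀ (ℓ : ℝ),
        ((∀ j, Metric.diam (J j) ≤ ℓ) ∧ (∃ j, ℓ = Metric.diam (J j))) →
      ∀ (f f' : ℝ → ℝ),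
        (∀ x ∈ Set.Icc a b, HasDerivWithinAt f (f' x) (Set.Icc a b) x) →
        (∀ x ∈ Set.Icc a b, κ ≤ f x) → (∀ x ∈ Set.Icc a b, f x ≤ M) →
        (∀ x ∈ Set.Icc a b, |f' x| ≤ M) →
        (∀ x ∈ Set.Icc a b, ∀ y ∈ Set.Icc a b, |f' x - f' y| ≤ K * |x - y| ^ γ) →
      ∀ (νs : Fin m → ℝ), (∀ j, νs j = ∫ x in J j, Real.sqrt (f x) ∂ν₀) →
      ∀ (sqfhat : ℝ → ℝ),
        (∀ j0 : Fin m, (j0 : ℕ) = 0 →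
          ∀ x ∈ Set.Icc a b, x ≤ xstar j0 → sqfhat x = νs j0 / μ) →
        (∀ j k : Fin m, (j : ℕ) + 1 = (k : ℕ) →
          ∀ x ∈ Set.Ioc (xstar j) (xstar k),
            sqfhat x = (νs k * (x - xstar j) + νs j * (xstar k - x))
              / (μ * (xstar k - xstar j))) →
        (∀ j : Fin m, (j : ℕ) = m - 1 →
          ∀ x ∈ Set.Icc a b, xstar j < x → sqfhat x = νs j / μ) →
      ∫ x in Set.Icc a b, (sqfhat x - Real.sqrt (f x)) ^ 2 ∂ν₀
        ≤ C * (μ * ℓ ^ 2 + ℓ ^ (2 + 2 * γ)) := by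
  set L : ℝ := M / (2 * √κ)
  set H : ℝ := K / (2 * √κ) + M * (L * |D| ^ (1 - γ)) / (2 * κ)
  have hs : 0 < √κ := Real.sqrt_pos.2 hκ
  have hL0 : 0 < L := by positivity
  have hH0 : 0 < H := by positivity
  refine ⟨2 * L ^ 2 + 25 * H ^ 2 * |V|, by positivity, ?_⟩
  intro a b hab hD ν hν hV m hm J hoc hdisj hU hord hmass μ hμ hμ0 xs hxs ℓ hℓ f f' hd hκf hfM
    hfb hfh νs hνs g hg0 hg1 hg2
  obtain ⟨hder, hlip, hhol⟩ := sqrt_deriv_bounds hκ hK hM hγ0 hγ1 hκf hd hfb hfh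
  rw [hD] at hhol
  have hmeas : ∀ j, MeasurableSet (J j) := fun j => (hoc j).measurableSet
  have hsub : ∀ j, J j ⊆ Set.Icc a b := fun j => hU ▸ Set.subset_iUnion J j
  have hreal : ∀ j, ν.real (J j) = μ := fun j => by
    rw [Measure.real, hmass j, hμ, ENNReal.toReal_div, ENNReal.toReal_natCast]
  have hpos : ∀ j, 0 < ν.real (J j) := fun j => (hreal j).symm ▸ hμ0
  have hdist : ∀ j, ∀ x ∈ J j, ∀ y ∈ J j, |x - y| ≤ ℓ := fun j x hx y hy =>
    (Metric.dist_le_diam_of_mem ((Metric.isBounded_Icc a b).subset (hsub j)) hx hy).trans (hℓ.1 j)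
  have hℓ0 : 0 ≤ ℓ := Metric.diam_nonneg.trans (hℓ.1 ⟨0, by omega⟩)
  have hcont : ContinuousOn (fun x => √(f x)) (Set.Icc a b) :=
    fun x hx => (hder x hx).continuousWithinAt
  have h_int : ∀ j, IntegrableOn (fun x => √(f x)) (J j) ν := fun j =>
    (hcont.integrableOn_compact isCompact_Icc).mono_set (hsub j)
  have hid : ∀ j, IntegrableOn (fun x => x) (J j) ν := fun j =>
    (continuousOn_id.integrableOn_compact (isCompact_Icc (a := a) (b := b))).mono_set (hsub j)
  replace hxs : ∀ j, xs j = (∫ x in J j, x ∂ν) / ν.real (J j) := fun j => by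
    rw [hxs j, hreal j]
  have hle : ∀ j c, (∀ x ∈ J j, x ≤ c) → xs j ≤ c := fun j c hc => by
    rw [hxs j]; exact setIntegral_div_le (hmeas j) (hpos j) (hid j) hc
  have hge : ∀ j c, (∀ x ∈ J j, c ≤ x) → c ≤ xs j := fun j c hc => by
    rw [hxs j]; exact le_setIntegral_div_s16 (hmeas j) (hpos j) (hid j) hc
  have hxsI : ∀ j, xs j ∈ Set.Icc a b := fun j =>
    ⟨hge j a fun x hx => (hsub j hx).1, hle j b fun x hx => (hsub j hx).2⟩
  have hnear : ∀ j, ∀ x ∈ J j, |x - xs j| ≤ ℓ := fun j x hx => by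
    have h1 := hle j (x + ℓ) fun y hy => by linarith [(abs_le.1 (hdist j y hy x hx)).2]
    have h2 := hge j (x - ℓ) fun y hy => by linarith [(abs_le.1 (hdist j y hy x hx)).1]
    rw [abs_le]; constructor <;> linarith
  set R : ℝ := ℓ ^ (1 + γ) with hR
  have hR0 : 0 ≤ R := Real.rpow_nonneg hℓ0 _
  have hRsq : R ^ 2 = ℓ ^ (2 + 2 * γ) := by
    rw [hR, ← Real.rpow_natCast, ← Real.rpow_mul hℓ0]; congr 1; push_cast; ring
  have h2R : (2 * ℓ) ^ (1 + γ) ≤ 4 * R := by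
    rw [Real.mul_rpow zero_le_two hℓ0]
    gcongr
    calc (2 : ℝ) ^ (1 + γ) ≤ 2 ^ (2 : ℝ) :=
          Real.rpow_le_rpow_of_exponent_le one_le_two (by linarith)
      _ = 4 := by norm_num
  have havg : ∀ j, |νs j / μ - √(f (xs j))| ≤ H * R := fun j => by
    rw [hνs j, ← hreal j]
    exact abs_setIntegral_div_sub_le_s16 (hmeas j) (hpos j) (h_int j) (hid j) (hxs j) fun x hx =>
      abs_sub_sub_mul_le_of_holder_deriv hH0.le hγ0.le hder hhol (hxsI j) (hsub j hx)
        (hnear j x hx)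
  have hcell : ∀ j, ∀ x ∈ J j, |νs j / μ - √(f x)| ≤ L * ℓ := fun j x hx => by
    rw [hνs j, ← hreal j]
    refine abs_setIntegral_div_sub_le_s16 (q := 0) (hmeas j) (hpos j) (h_int j) (hid j) (hxs j)
      fun y hy => ?_
    rw [zero_mul, sub_zero]
    refine (hlip y (hsub j hy) x (hsub j hx)).trans ?_
    have := hdist j y hy x hx
    gcongr
  have hgap : ∀ j k : Fin m, (j : ℕ) + 1 = k → xs k - xs j ≤ 2 * ℓ := fun j k hjk => by
    have := hge j (xs k - 2 * ℓ) fun x hx => by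
      linarith [hle k (x + 2 * ℓ) fun y hy => by
        linarith [sub_le_two_mul_of_consecutive hU hord hdist hjk hx hy]]
    linarith
  let i₀ : Fin m := ⟨0, by omega⟩
  let i₁ : Fin m := ⟨m - 1, by omega⟩
  have hptw : ∀ x ∈ Set.Icc a b, (g x - √(f x)) ^ 2 ≤
      (J i₀).indicator (fun _ => (L * ℓ) ^ 2) x + (J i₁).indicator (fun _ => (L * ℓ) ^ 2) x
        + (5 * H * R) ^ 2 := by
    intro x hx
    have hn : ∀ j, 0 ≤ (J j).indicator (fun _ => (L * ℓ) ^ 2) x := fun j =>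
      Set.indicator_nonneg (fun _ _ => sq_nonneg _) x
    have hcellsq : ∀ j, x ∈ J j → g x = νs j / μ →
        (g x - √(f x)) ^ 2 ≤ (J j).indicator (fun _ => (L * ℓ) ^ 2) x := fun j hj he => by
      rw [Set.indicator_of_mem hj, he]
      exact sq_le_sq' (abs_le.1 (hcell j x hj)).1 (abs_le.1 (hcell j x hj)).2
    have hsmall : |g x - √(f x)| ≤ 5 * H * R → (g x - √(f x)) ^ 2 ≤ (5 * H * R) ^ 2 :=
      fun h => sq_le_sq' (abs_le.1 h).1 (abs_le.1 h).2
    have hn0 := hn i₀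
    have hn1 := hn i₁
    have hn2 := sq_nonneg (5 * H * R)
    obtain ⟨i, hi⟩ := Set.mem_iUnion.1 (hU ▸ hx : x ∈ ⋃ j, J j)
    by_cases hlow : x ≤ xs i₀
    · have he := hg0 i₀ rfl x hx hlow
      by_cases hmem : x ∈ J i₀
      · linarith [hcellsq i₀ hmem he]
      · have hlt : i₀ < i := by
          rw [Fin.lt_def]
          have : (i : ℕ) ≠ 0 := fun h => hmem ((Fin.ext h : i = i₀) ▸ hi)
          change 0 < (i : ℕ)
          omega
        have hxe : x = xs i₀ := le_antisymm hlow (hle i₀ x fun y hy => hord i₀ i hlt y hy x hi)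
        have : |g x - √(f x)| ≤ 5 * H * R := by
          rw [he, hxe]
          refine (havg i₀).trans ?_
          nlinarith [mul_nonneg hH0.le hR0]
        linarith [hsmall this]
    · by_cases hhigh : xs i₁ < x
      · have he := hg2 i₁ rfl x hx hhigh
        have hmem : x ∈ J i₁ := by
          by_contra hmem
          have hlt : i < i₁ := by
            rw [Fin.lt_def]
            have : (i : ℕ) ≠ m - 1 := fun h => hmem ((Fin.ext h : i = i₁) ▸ hi)
            have := i.2
            change (i : ℕ) < m - 1
            omega
          exact absurd (hge i₁ x fun y hy => hord i i₁ hlt x hi y hy) (not_le.2 hhigh)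
        linarith [hcellsq i₁ hmem he]
      · obtain ⟨j, k, hjk, hxjk⟩ :=
          exists_consecutive_mem_Ioc i₀ i₁ rfl (not_le.1 hlow) (not_lt.1 hhigh)
        have hgjk := hgap j k hjk
        have hTaylor : ∀ y ∈ Set.Icc a b, |y - x| ≤ 2 * ℓ →
            |√(f y) - √(f x) - f' x / (2 * √(f x)) * (y - x)| ≤ H * (4 * R) := fun y hy hyx =>
          (abs_sub_sub_mul_le_of_holder_deriv hH0.le hγ0.le hder hhol hx hy hyx).trans
            (by gcongr)
        have hb := abs_interpolation_sub_le hxjk (havg j) (havg k)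
          (hTaylor _ (hxsI j) (by rw [abs_le]; constructor <;> linarith [hxjk.1, hxjk.2]))
          (hTaylor _ (hxsI k) (by rw [abs_le]; constructor <;> linarith [hxjk.1, hxjk.2]))
        have he : g x = (νs k / μ * (x - xs j) + νs j / μ * (xs k - x)) / (xs k - xs j) := by
          rw [hg1 j k hjk x hxjk, ← div_div]
          congr 1
          field_simp
        rw [← he] at hb
        linarith [hsmall (hb.trans (by linarith))]
  have hindint : ∀ j, IntegrableOn ((J j).indicator fun _ => (L * ℓ) ^ 2) (Set.Icc a b) ν :=
    fun j => (integrable_const _).indicator (hmeas j)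
  have hindval : ∀ j, ∫ x in Set.Icc a b, (J j).indicator (fun _ => (L * ℓ) ^ 2) x ∂ν
      = μ * (L * ℓ) ^ 2 := fun j => by
    rw [setIntegral_indicator (hmeas j), Set.inter_eq_right.2 (hsub j), setIntegral_const, hreal j,
      smul_eq_mul]
  have hind2 : IntegrableOn (fun x => (J i₀).indicator (fun _ => (L * ℓ) ^ 2) x
      + (J i₁).indicator (fun _ => (L * ℓ) ^ 2) x) (Set.Icc a b) ν :=
    (hindint i₀).add (hindint i₁)
  have hVr : ν.real (Set.Icc a b) = V := hV
  have hV0 : 0 ≤ V := hVr ▸ measureReal_nonneg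
  calc ∫ x in Set.Icc a b, (g x - √(f x)) ^ 2 ∂ν
      ≤ ∫ x in Set.Icc a b, ((J i₀).indicator (fun _ => (L * ℓ) ^ 2) x
          + (J i₁).indicator (fun _ => (L * ℓ) ^ 2) x + (5 * H * R) ^ 2) ∂ν :=
        integral_mono_of_nonneg (Filter.Eventually.of_forall fun x => sq_nonneg _)
          (Integrable.add hind2 (integrable_const _))
          ((ae_restrict_iff' measurableSet_Icc).2 (Filter.Eventually.of_forall hptw))
    _ = 2 * L ^ 2 * (μ * ℓ ^ 2) + 25 * H ^ 2 * |V| * ℓ ^ (2 + 2 * γ) := by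
        rw [integral_add hind2 (integrable_const _),
          integral_add (hindint i₀) (hindint i₁), hindval, hindval, setIntegral_const, hVr,
          smul_eq_mul, abs_of_nonneg hV0, ← hRsq]
        ring
    _ ≤ (2 * L ^ 2 + 25 * H ^ 2 * |V|) * (μ * ℓ ^ 2 + ℓ ^ (2 + 2 * γ)) := by
        have h1 : 0 ≤ 2 * L ^ 2 * ℓ ^ (2 + 2 * γ) := by positivity
        have h2 : 0 ≤ 25 * H ^ 2 * |V| * (μ * ℓ ^ 2) := by positivity
        nlinarith
end
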